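/- arXiv:1001.4888 — 8 statements merged into one kernel-verified Lean document; each statement's English description precedes it below -/
import Mathlib

section
/- For every n ≥ 2, the ideals {J_i : i < n} on the n-ary tree T = n^{<ω} are pairwise orthogonal and are not weakly countably separated; in particular, they form an n-gap. -/
/-- An ideal on a countable set `E`: contains all finite sets, closed under
finite unions and subsets. -/
def IsIdeal {E : Type*} (I : Set (Set E)) : Prop :=
  (∀ s : Set E, s.Finite → s ∈ I) ∧
  (∀ a ∈ I, ∀ b ∈ I, a ∪ b ∈ I) ∧
  (∀ a ∈ I, ∀ b : Set E, b ⊆ a → b ∈ I)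

/-- Two families of sets are orthogonal (mod finite). -/
def Orth {E : Type*} (I J : Set (Set E)) : Prop := ∀ a ∈ I, ∀ b ∈ J, (a ∩ b).Finite

/-- `I ≤ c` mod finite: every member of `I` is almost contained in `c`. -/
def IdealLe {E : Type*} (I : Set (Set E)) (c : Set E) : Prop := ∀ x ∈ I, (x \ c).Finite

/-- `b ∈ I^⊥`: `b` has finite intersection with every member of `I`. -/
def InPerp {E : Type*} (b : Set E) (I : Set (Set E)) : Prop := ∀ x ∈ I, (b ∩ x).Finite

/-- The restriction `I|_a = {x ∈ I : x \ a finite}`. -/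
def Restrict {E : Type*} (I : Set (Set E)) (a : Set E) : Set (Set E) :=
  {x ∈ I | (x \ a).Finite}

/-- The family `{I_i : i ∈ A}` is a multiple gap: pairwise orthogonal and for any
sets `c i` with `I i ≤ c i` (for `i ∈ A`), the intersection `⋂ i ∈ A, c i` is infinite. -/
def MultiGap {E : Type*} {n : ℕ} (A : Set (Fin n)) (I : Fin n → Set (Set E)) : Prop :=
  (∀ i ∈ A, ∀ j ∈ A, i ≠ j → Orth (I i) (I j)) ∧
  ∀ c : Fin n → Set E, (∀ i ∈ A, IdealLe (I i) (c i)) → (⋂ i ∈ A, c i).Infinite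

/-- An `n`-gap: a multiple gap indexed by all of `n`. -/
def IsGap {E : Type*} {n : ℕ} (I : Fin n → Set (Set E)) : Prop := MultiGap Set.univ I

/-- `{I_i : i < n}` is a `B`-jigsaw. -/
def IsBJigsaw {E : Type*} {n : ℕ} (I : Fin n → Set (Set E)) (B : Set (Fin n)) : Prop :=
  ∀ A : Set (Fin n), B ⊆ A → ∀ a : Set E,
    MultiGap A (fun i => Restrict (I i) a) →
    ∃ b : Set E, b ⊆ a ∧ MultiGap B (fun i => Restrict (I i) b) ∧
      ∀ i ∈ A \ B, InPerp b (I i)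

/-- `{I_i : i < n}` is a `B`-clover. -/
def IsBClover {E : Type*} {n : ℕ} (I : Fin n → Set (Set E)) (B : Set (Fin n)) : Prop :=
  ¬ ∃ b : Set E, MultiGap B (fun i => Restrict (I i) b) ∧
      ∀ i ∈ Set.univ \ B, InPerp b (I i)

/-- Weak countable separation. -/
def WeaklyCS {E : Type*} {n : ℕ} (I : Fin n → Set (Set E)) : Prop :=
  ∃ c : Fin n → ℕ → Set E,
    (∀ k, (⋂ i, c i k).Finite) ∧
    ∀ x : Fin n → Set E, (∀ i, x i ∈ I i) → ∃ k, ∀ i, (x i \ c i k).Finite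

/-- Strong countable separation. -/
def StronglyCS {E : Type*} {n : ℕ} (I : Fin n → Set (Set E)) : Prop :=
  ∃ c : Fin n → ℕ → Set E,
    (∀ k, ∀ i j : Fin n, i ≠ j → (c i k ∩ c j k).Finite) ∧
    ∀ x : Fin n → Set E, (∀ i, x i ∈ I i) → ∃ k, ∀ i, (x i \ c i k).Finite

/-- The ideal generated by a family `G` of subsets of `E`: all sets almost covered by
finitely many members of `G`. -/
def GenIdeal {E : Type*} (G : Set (Set E)) : Set (Set E) :=
  {b | ∃ F : Finset (Set E), ↑F ⊆ G ∧ (b \ ⋃₀ ↑F).Finite}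

/-- `s` is an initial segment of the branch `x ∈ n^ω`. -/
def IsInitSeg {n : ℕ} (s : List (Fin n)) (x : ℕ → Fin n) : Prop :=
  ∀ k : ℕ, ∀ h : k < s.length, s.get ⟨k, h⟩ = x k

/-- `a_x^i = {s ∈ n^{<ω} : s⌢i is an initial segment of x}`. -/
def sideSet {n : ℕ} (x : ℕ → Fin n) (i : Fin n) : Set (List (Fin n)) :=
  {s | IsInitSeg (s ++ [i]) x}

/-- The ideal `J_i` on the `n`-ary tree generated by the sets `a_x^i`, `x ∈ n^ω`. -/
def treeIdeal (n : ℕ) (i : Fin n) : Set (Set (List (Fin n))) :=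
  GenIdeal {a | ∃ x : ℕ → Fin n, a = sideSet x i}

theorem isInitSeg_append_singleton {n : ℕ} {s : List (Fin n)} {i : Fin n} {x : ℕ → Fin n} :
    IsInitSeg (s ++ [i]) x ↔ IsInitSeg s x ∧ x s.length = i := by
  constructor
  · intro h
    refine ⟨fun k hk => ?_, ?_⟩
    · have := h k (by simp; omega)
      simpa [List.getElem_append_left hk] using this
    · have := h s.length (by simp)
      simpa using this.symm
  · rintro ⟨h, hi⟩ k hk
    have hk' : k < s.length + 1 := by simpa using hk
    rcases Nat.lt_succ_iff_lt_or_eq.mp hk' with hlt | rfl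
    · simpa [List.getElem_append_left hlt] using h k hlt
    · simpa using hi.symm

theorem IsInitSeg.eq_of_length_eq {n : ℕ} {s t : List (Fin n)} {x : ℕ → Fin n}
    (hs : IsInitSeg s x) (ht : IsInitSeg t x) (h : s.length = t.length) : s = t :=
  List.ext_getElem h fun k hk hk' => (hs k hk).trans (ht k hk').symm

theorem isInitSeg_map_range {n : ℕ} {x y : ℕ → Fin n} {j : ℕ} (h : ∀ k < j, x k = y k) :
    IsInitSeg ((List.range j).map x) y := by
  intro k hk
  simpa using h k (by simpa using hk)

theorem sideSet_mem_treeIdeal {n : ℕ} (x : ℕ → Fin n) (i : Fin n) :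
    sideSet x i ∈ treeIdeal n i :=
  ⟨{sideSet x i}, by simpa using ⟨x, rfl⟩, by simp⟩

theorem sideSet_inter_subsingleton {n : ℕ} (x y : ℕ → Fin n) {i j : Fin n} (hij : i ≠ j) :
    (sideSet x i ∩ sideSet y j).Subsingleton := by
  have length_not_lt : ∀ s ∈ sideSet x i ∩ sideSet y j, ∀ t ∈ sideSet x i ∩ sideSet y j,
      ¬ s.length < t.length := by
    rintro s ⟨hsx, hsy⟩ t ⟨htx, hty⟩ hlt
    have hsx := (isInitSeg_append_singleton.mp hsx).2
    have hsy := (isInitSeg_append_singleton.mp hsy).2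
    have htx := (isInitSeg_append_singleton.mp htx).1 _ hlt
    have hty := (isInitSeg_append_singleton.mp hty).1 _ hlt
    exact hij (hsx.symm.trans (htx.symm.trans (hty.trans hsy)))
  intro s hs t ht
  exact (isInitSeg_append_singleton.mp hs.1).1.eq_of_length_eq
    (isInitSeg_append_singleton.mp ht.1).1
    (le_antisymm (not_lt.mp (length_not_lt t ht s hs)) (not_lt.mp (length_not_lt s hs t ht)))

theorem Orth.genIdeal {E : Type*} {G H : Set (Set E)} (h : Orth G H) :
    Orth (GenIdeal G) (GenIdeal H) := by
  rintro a ⟨F, hF, haF⟩ b ⟨K, hK, hbK⟩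
  have hFK : (⋃ f ∈ F, ⋃ g ∈ K, f ∩ g).Finite :=
    F.finite_toSet.biUnion fun f hf => K.finite_toSet.biUnion fun g hg => h f (hF hf) g (hK hg)
  refine ((haF.union hbK).union hFK).subset ?_
  rintro s ⟨hsa, hsb⟩
  by_cases hs : s ∈ ⋃₀ (F : Set (Set E))
  · by_cases hs' : s ∈ ⋃₀ (K : Set (Set E))
    · obtain ⟨f, hf, hsf⟩ := hs
      obtain ⟨g, hg, hsg⟩ := hs'
      exact Or.inr (Set.mem_biUnion hf (Set.mem_biUnion hg ⟨hsf, hsg⟩))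
    · exact Or.inl (Or.inr ⟨hsb, hs'⟩)
  · exact Or.inl (Or.inl ⟨hsa, hs⟩)

theorem treeIdeal_orth {n : ℕ} {i j : Fin n} (hij : i ≠ j) :
    Orth (treeIdeal n i) (treeIdeal n j) := by
  refine Orth.genIdeal ?_
  rintro _ ⟨x, rfl⟩ _ ⟨y, rfl⟩
  exact (sideSet_inter_subsingleton x y hij).finite

theorem isOpen_setOf_isInitSeg {n : ℕ} (s : List (Fin n)) :
    IsOpen {x : ℕ → Fin n | IsInitSeg s x} := by
  have : {x : ℕ → Fin n | IsInitSeg s x} = ⋂ k : Fin s.length, {x | s.get k = x k} := by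
    ext x
    simp [IsInitSeg, Fin.forall_iff]
  rw [this]
  exact isOpen_iInter_of_finite fun k =>
    (isOpen_discrete {a | s.get k = a}).preimage (continuous_apply (k : ℕ))

theorem not_weaklyCS_treeIdeal {n : ℕ} [NeZero n] : ¬ WeaklyCS (treeIdeal n) := by
  rintro ⟨c, hfin, hsep⟩
  let C : ℕ × ℕ → Set (ℕ → Fin n) := fun p =>
    {x | ∀ i s, p.2 ≤ s.length → IsInitSeg (s ++ [i]) x → s ∈ c i p.1}
  have hC : ∀ p, IsClosed (C p) := by
    intro p
    simp only [C, Set.ofPred_forall]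
    exact isClosed_iInter fun i => isClosed_iInter fun s => isClosed_iInter fun _ =>
      isClosed_imp (isOpen_setOf_isInitSeg (s ++ [i])) isClosed_const
  have hcover : ⋃ p, C p = Set.univ := by
    refine Set.eq_univ_of_forall fun x => ?_
    obtain ⟨k, hk⟩ := hsep (sideSet x) (sideSet_mem_treeIdeal x)
    obtain ⟨M, hM⟩ := ((Set.finite_iUnion hk).image List.length).bddAbove
    refine Set.mem_iUnion.mpr ⟨(k, M + 1), fun i s hs hx => by_contra fun hsc => ?_⟩
    have := hM ⟨s, Set.mem_iUnion.mpr ⟨i, hx, hsc⟩, rfl⟩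
    dsimp only at hs
    omega
  obtain ⟨⟨k, m⟩, x, hx⟩ := nonempty_interior_of_iUnion_of_closed hC hcover
  obtain ⟨I, u, hu, hI⟩ := isOpen_pi_iff.mp isOpen_interior x hx
  obtain ⟨N, hN⟩ := I.bddAbove
  have hmem : ∀ j > max m N, (List.range j).map x ∈ ⋂ i, c i k := by
    intro j hj
    refine Set.mem_iInter.mpr fun i => ?_
    have hy : Function.update x j i ∈ C (k, m) := by
      refine interior_subset (hI fun l hl => ?_)
      have : l ≤ N := hN hl
      rw [Function.update_of_ne (by omega)]
      exact (hu l hl).2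
    refine hy i _ (by simp; omega) (isInitSeg_append_singleton.mpr
      ⟨isInitSeg_map_range fun l hl => ?_, by simp⟩)
    rw [Function.update_of_ne hl.ne]
  refine (Set.infinite_of_injOn_mapsTo ?_ hmem (Set.Ioi_infinite (max m N))) (hfin k)
  intro j _ l _ h
  simpa using congrArg List.length h

theorem isGap_of_orth_of_not_weaklyCS {E : Type*} {n : ℕ} {I : Fin n → Set (Set E)}
    (horth : ∀ i j, i ≠ j → Orth (I i) (I j)) (hsep : ¬ WeaklyCS I) : IsGap I := by
  refine ⟨fun i _ j _ => horth i j, fun c hc hfin => hsep ⟨fun i _ => c i, fun _ => ?_, ?_⟩⟩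
  · simpa using hfin
  · exact fun x hx => ⟨0, fun i => hc i trivial (x i) (hx i)⟩


/-- The ideals `{J_i : i < n}` on the `n`-ary tree `T = n^{<ω}` are pairwise orthogonal
and not weakly countably separated; in particular they form an `n`-gap. -/
theorem treeIdeals_orth_notWeaklyCS_gap (n : ℕ) (hn : 2 ≤ n) :
    (∀ i j : Fin n, i ≠ j → Orth (treeIdeal n i) (treeIdeal n j)) ∧
    ¬ WeaklyCS (treeIdeal n) ∧
    IsGap (treeIdeal n) := by
  have : NeZero n := ⟨by omega⟩
  have horth : ∀ i j : Fin n, i ≠ j → Orth (treeIdeal n i) (treeIdeal n j) :=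
    fun _ _ => treeIdeal_orth
  exact ⟨horth, not_weaklyCS_treeIdeal,
    isGap_of_orth_of_not_weaklyCS horth not_weaklyCS_treeIdeal⟩
end

section
/- For every n ≥ 2, the n-gap {J_i : i < n} on the n-ary tree T = n^{<ω} is a jigsaw, i.e., it is a B-jigsaw for every nonempty proper subset B of n. -/
theorem GenIdeal.inter_finite {E : Type*} {G : Set (Set E)} {y d : Set E}
    (hy : y ∈ GenIdeal G) (h : ∀ f ∈ G, (f ∩ d).Finite) : (y ∩ d).Finite := by
  obtain ⟨F, hFG, hF⟩ := hy
  refine (hF.union (F.finite_toSet.biUnion fun f hf => h f (hFG hf))).subset ?_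
  rintro u ⟨hu, hd⟩
  by_cases hc : u ∈ ⋃₀ (↑F : Set (Set E))
  · obtain ⟨f, hf, huf⟩ := hc
    exact Or.inr (Set.mem_biUnion hf ⟨huf, hd⟩)
  · exact Or.inl ⟨hu, hc⟩

theorem GenIdeal.of_subset_mem {E : Type*} {G : Set (Set E)} {f y : Set E}
    (hf : f ∈ G) (h : y ⊆ f) : y ∈ GenIdeal G := by
  refine ⟨{f}, by simpa using hf, ?_⟩
  have : y \ ⋃₀ (↑({f} : Finset (Set E))) = ∅ := by
    simpa [Set.sdiff_eq_empty] using h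
  rw [this]
  exact Set.finite_empty

theorem isInitSeg_iff {n : ℕ} {s : List (Fin n)} {x : ℕ → Fin n} :
    IsInitSeg s x ↔ s = (List.range s.length).map x := by
  constructor
  · intro h
    apply List.ext_getElem
    · simp
    · intro k h₁ h₂
      simpa using h k h₁
  · intro h k hk
    have := List.getElem_of_eq h hk
    simpa using this

theorem IsInitSeg.of_prefix {n : ℕ} {s t : List (Fin n)} {x : ℕ → Fin n}
    (h : IsInitSeg t x) (hst : s <+: t) : IsInitSeg s x := by
  obtain ⟨r, rfl⟩ := hst
  intro k hk
  have := h k (by simp; omega)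
  simpa [List.getElem_append_left hk] using this

theorem IsInitSeg.prefix_of_length_le {n : ℕ} {s t : List (Fin n)} {x : ℕ → Fin n}
    (hs : IsInitSeg s x) (ht : IsInitSeg t x) (h : s.length ≤ t.length) : s <+: t := by
  rw [isInitSeg_iff] at hs ht
  rw [hs, ht]
  obtain ⟨d, hd⟩ := Nat.exists_eq_add_of_le h
  rw [hd, List.range_add, List.map_append]
  exact List.prefix_append _ _

theorem exists_branch {n : ℕ} {s : ℕ → List (Fin n)} (hs : ∀ k, s k <+: s (k + 1))
    (hl : ∀ k, k ≤ (s k).length) : ∃ x : ℕ → Fin n, ∀ k, IsInitSeg (s k) x := by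
  have hmono : ∀ {k l : ℕ}, k ≤ l → s k <+: s l := fun h =>
    Nat.le_induction (List.prefix_refl _) (fun l _ ih => ih.trans (hs l)) _ h
  refine ⟨fun m => (s (m + 1)).get ⟨m, hl (m + 1)⟩, fun k m hm => ?_⟩
  rcases le_total k (m + 1) with h | h
  · exact (hmono h).getElem hm
  · exact ((hmono h).getElem (hl (m + 1))).symm

theorem sideSet_inter_finite {n : ℕ} (x y : ℕ → Fin n) {i j : Fin n} (hij : i ≠ j) :
    (sideSet x i ∩ sideSet y j).Finite := by
  by_cases hxy : x = y
  · subst hxy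
    have : sideSet x i ∩ sideSet x j = ∅ := by
      ext s
      simp only [Set.mem_inter_iff, Set.mem_empty_iff_false, iff_false, not_and]
      intro h₁ h₂
      have := (h₁.prefix_of_length_le h₂ (by simp)).eq_of_length (by simp)
      simp at this
      exact hij this
    rw [this]
    exact Set.finite_empty
  · obtain ⟨m, hm⟩ := Function.ne_iff.mp hxy
    refine (List.finite_length_le (Fin n) m).subset ?_
    rintro s ⟨h₁, h₂⟩
    by_contra hlt
    have hlt : m < s.length := by simpa using hlt
    exact hm ((h₁.of_prefix (List.prefix_append _ _) m hlt).symm.trans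
      (h₂.of_prefix (List.prefix_append _ _) m hlt))

/-- `S` spans a copy of the `B`-branching tree whose branching nodes lie in `a`. -/
def IsBranching {n : ℕ} (B : Set (Fin n)) (a S : Set (List (Fin n))) : Prop :=
  S.Nonempty ∧ ∀ s ∈ S, ∃ t ∈ a, s <+: t ∧ ∀ i ∈ B, t ++ [i] ∈ S

theorem IsBranching.multiGap {n : ℕ} {B : Set (Fin n)} {a S : Set (List (Fin n))}
    (hB : B.Nonempty) (h : IsBranching B a S) :
    MultiGap B (fun i => Restrict (treeIdeal n i) a) := by
  refine ⟨fun i _ j _ hij y hy z hz => treeIdeal_orth hij y hy.1 z hz.1, fun c hc hfin => ?_⟩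
  obtain ⟨⟨s₀, hs₀⟩, hS⟩ := h
  choose g hga hgp hgS using hS
  obtain ⟨i₀, hi₀⟩ := hB
  have hdir : ∀ t : List (Fin n), ∃ i ∈ B, t ∈ (⋂ i ∈ B, c i) ∨ t ∉ c i := by
    intro t
    by_cases ht : t ∈ ⋂ i ∈ B, c i
    · exact ⟨i₀, hi₀, Or.inl ht⟩
    · simp only [Set.mem_iInter, not_forall] at ht
      obtain ⟨i, hi, hti⟩ := ht
      exact ⟨i, hi, Or.inr hti⟩
  choose d hdB hd using hdir
  let σ : ℕ → S := fun k => Nat.rec ⟨s₀, hs₀⟩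
    (fun _ s => ⟨g s.1 s.2 ++ [d (g s.1 s.2)], hgS s.1 s.2 _ (hdB _)⟩) k
  let t : ℕ → List (Fin n) := fun k => g (σ k).1 (σ k).2
  have hσ : ∀ k, (σ (k + 1)).1 = t k ++ [d (t k)] := fun k => rfl
  have hσt : ∀ k, (σ k).1 <+: t k := fun k => hgp _ _
  have hlen : ∀ k, (σ k).1.length < (σ (k + 1)).1.length := fun k => by
    have := (hσt k).length_le
    rw [hσ]
    simp
    omega
  obtain ⟨x, hx⟩ := exists_branch (s := fun k => (σ k).1)
    (fun k => (hσt k).trans (by rw [hσ]; exact List.prefix_append _ _))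
    (fun _ => (strictMono_nat_of_lt_succ (f := fun k => (σ k).1.length) hlen).le_apply)
  have hmono : StrictMono fun k => (t k).length := strictMono_nat_of_lt_succ fun k => by
    have := (hσt (k + 1)).length_le
    rw [hσ] at this
    simp at this
    omega
  have hinj : Function.Injective t := fun k l hkl =>
    hmono.injective (congrArg List.length hkl)
  have hside : ∀ i ∈ B, ((sideSet x i ∩ a) \ c i).Finite := fun i hi =>
    hc i hi _ ⟨GenIdeal.of_subset_mem ⟨x, rfl⟩ Set.inter_subset_left,
      Set.finite_empty.subset fun u hu => hu.2 hu.1.2⟩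
  refine Set.infinite_of_injective_forall_mem hinj (fun k => ?_)
    (hfin.union (B.toFinite.biUnion hside))
  rcases hd (t k) with h | h
  · exact Or.inl h
  · refine Or.inr (Set.mem_biUnion (hdB (t k)) ⟨⟨?_, hga _ _⟩, h⟩)
    have := hx (k + 1)
    simp only [hσ] at this
    exact this

/-- The part of `a` above `s` is separated in the directions of `B`. -/
def IsSeparatedAbove {n : ℕ} (B : Set (Fin n)) (a : Set (List (Fin n)))
    (s : List (Fin n)) : Prop :=
  ∃ c : Fin n → Set (List (Fin n)),
    (∀ t ∈ a, s <+: t → ∃ i ∈ B, t ∉ c i) ∧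
    ∀ i ∈ B, ∀ x : ℕ → Fin n, {u ∈ a | s <+: u ∧ u ∈ sideSet x i ∧ u ∉ c i}.Finite

theorem isSeparatedAbove_of_forall {n : ℕ} {B : Set (Fin n)} (hB : B.Nonempty)
    {a : Set (List (Fin n))} {s : List (Fin n)}
    (h : ∀ t ∈ a, s <+: t → ∃ i ∈ B, IsSeparatedAbove B a (t ++ [i])) :
    IsSeparatedAbove B a s := by
  classical
  obtain ⟨i₀, -⟩ := hB
  have : Nonempty (Fin n) := ⟨i₀⟩
  choose! d hdB c hc hfin using h
  let P : List (Fin n) → ℕ → Prop := fun u k =>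
    ∃ t ∈ a, s <+: t ∧ t ++ [d t] <+: u ∧ t.length = k
  have hsep : ∀ u ∈ a, s <+: u → ∃ e : Set (Fin n), (∃ i ∈ B, i ∉ e) ∧
      ((∀ t ∈ a, s <+: t → ¬ t ++ [d t] <+: u) → d u ∉ e ∧ ∀ i, i ≠ d u → i ∈ e) ∧
      ∀ t ∈ a, s <+: t → t ++ [d t] <+: u →
        (∀ t' ∈ a, s <+: t' → t' ++ [d t'] <+: u → t.length ≤ t'.length) →
        ∀ i, u ∈ c t i → i ∈ e := by
    intro u hu hsu
    by_cases hP : ∃ k, P u k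
    · obtain ⟨t, hta, hst, htu, htk⟩ := Nat.find_spec hP
      obtain ⟨i, hi, hui⟩ := hc t hta hst u hu htu
      refine ⟨{i | u ∈ c t i}, ⟨i, hi, hui⟩, fun hno => (hno t hta hst htu).elim, ?_⟩
      intro t' ht'a hst' ht'u hmin j hj
      have h₁ := Nat.find_min' hP ⟨t', ht'a, hst', ht'u, rfl⟩
      have h₂ := hmin t hta hst htu
      have : t' = t := (List.prefix_of_prefix_length_le ((List.prefix_append _ _).trans ht'u)
        ((List.prefix_append _ _).trans htu) h₂).eq_of_length (by omega)
      subst this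
      exact hj
    · refine ⟨{i | i ≠ d u}, ⟨d u, hdB u hu hsu, by simp⟩, fun _ => by simp, ?_⟩
      intro t hta hst htu
      exact (hP ⟨_, t, hta, hst, htu, rfl⟩).elim
  choose! e heB he_none he_min using hsep
  refine ⟨fun i => {u | i ∈ e u}, fun t ht hst => heB t ht hst, fun i hi x => ?_⟩
  by_cases hQ : ∃ k, ∃ t ∈ a, s <+: t ∧ IsInitSeg (t ++ [d t]) x ∧ t.length = k
  · obtain ⟨t, hta, hst, htx, htk⟩ := Nat.find_spec hQ
    refine ((List.finite_length_le (Fin n) t.length).union (hfin t hta hst i hi x)).subset ?_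
    rintro u ⟨hua, hsu, hux, hue⟩
    rcases le_or_gt u.length t.length with hl | hl
    · exact Or.inl hl
    · have hux' : IsInitSeg u x := hux.of_prefix (List.prefix_append _ _)
      have htu : t ++ [d t] <+: u := htx.prefix_of_length_le hux' (by simpa using hl)
      refine Or.inr ⟨hua, htu, hux, fun hc' => hue ?_⟩
      refine he_min u hua hsu t hta hst htu (fun t' ht'a hst' ht'u => ?_) i hc'
      rw [htk]
      exact Nat.find_min' hQ ⟨t', ht'a, hst', hux'.of_prefix ht'u, rfl⟩
  · refine Set.finite_empty.subset ?_
    rintro u ⟨hua, hsu, hux, hue⟩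
    have hux' : IsInitSeg u x := hux.of_prefix (List.prefix_append _ _)
    have h₁ := (he_none u hua hsu fun t hta hst htu =>
      hQ ⟨_, t, hta, hst, hux'.of_prefix htu, rfl⟩).2 i
    have h₂ : i = d u := by
      by_contra hne
      exact hue (h₁ hne)
    subst h₂
    exact hQ ⟨_, u, hua, hsu, hux, rfl⟩

theorem not_isSeparatedAbove_nil {n : ℕ} {A B : Set (Fin n)} (hBA : B ⊆ A)
    (hB : B.Nonempty) {a : Set (List (Fin n))}
    (h : MultiGap A (fun i => Restrict (treeIdeal n i) a)) :
    ¬ IsSeparatedAbove B a [] := by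
  rintro ⟨c, hc, hfin⟩
  obtain ⟨i₀, hi₀⟩ := hB
  refine h.2 (fun i => {u | i ∈ B → u ∈ a ∩ c i}) ?_ (Set.finite_empty.subset fun u hu => ?_)
  · rintro i - y ⟨hy, hya⟩
    by_cases hi : i ∈ B
    · refine (hya.union (GenIdeal.inter_finite (d := a \ c i) hy ?_)).subset ?_
      · rintro _ ⟨x, rfl⟩
        exact (hfin i hi x).subset fun u hu =>
          ⟨hu.2.1, List.nil_prefix, hu.1, hu.2.2⟩
      · rintro u ⟨huy, hu⟩
        by_cases hua : u ∈ a
        · exact Or.inr ⟨huy, hua, fun hc' => hu fun _ => ⟨hua, hc'⟩⟩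
        · exact Or.inl ⟨huy, hua⟩
    · exact Set.finite_empty.subset fun u hu => hu.2 fun hi' => (hi hi').elim
  · have hu' : ∀ i ∈ B, u ∈ a ∩ c i := fun i hi => Set.mem_iInter₂.mp hu i (hBA hi) hi
    obtain ⟨i, hi, hui⟩ := hc u (hu' i₀ hi₀).1 List.nil_prefix
    exact (hui (hu' i hi).2).elim

theorem exists_isBranching_of_multiGap {n : ℕ} {A B : Set (Fin n)} (hBA : B ⊆ A)
    (hB : B.Nonempty) {a : Set (List (Fin n))}
    (h : MultiGap A (fun i => Restrict (treeIdeal n i) a)) :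
    ∃ S, [] ∈ S ∧ IsBranching B a S := by
  have hnil := not_isSeparatedAbove_nil hBA hB h
  refine ⟨{s | ¬ IsSeparatedAbove B a s}, hnil, ⟨[], hnil⟩, fun s hs => ?_⟩
  by_contra! hcon
  refine hs (isSeparatedAbove_of_forall hB fun t hta hst => ?_)
  simpa using hcon t hta hst

theorem IsBranching.exists_subset {n : ℕ} {B : Set (Fin n)} {a S : Set (List (Fin n))}
    (hnil : [] ∈ S) (h : IsBranching B a S) :
    ∃ b ⊆ a, (∃ S', IsBranching B b S') ∧
      ∀ u ∈ b, ∀ t ∈ b, ∀ i, u ++ [i] <+: t → i ∈ B := by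
  classical
  let N : Set (List (Fin n)) := {t ∈ a | ∀ i ∈ B, t ++ [i] ∈ S}
  let R : Set (List (Fin n)) := {t | ∀ u ∈ N, ∀ i, u ++ [i] <+: t → i ∈ B}
  refine ⟨N ∩ R, fun t ht => ht.1.1, ⟨S ∩ R, ⟨[], hnil, ?_⟩, ?_⟩,
    fun u hu t ht i hut => ht.2 u hu.1 i hut⟩
  · intro u _ i hu
    simp at hu
  · rintro s ⟨hsS, hsR⟩
    have hex : ∃ k, ∃ t ∈ N, s <+: t ∧ t.length = k := by
      obtain ⟨t, hta, hst, ht⟩ := h.2 s hsS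
      exact ⟨_, t, ⟨hta, ht⟩, hst, rfl⟩
    obtain ⟨t, htN, hst, htk⟩ := Nat.find_spec hex
    have htR : t ∈ R := by
      intro u hu i hut
      rcases le_or_gt (u ++ [i]).length s.length with hl | hl
      · exact hsR u hu i (List.prefix_of_prefix_length_le hut hst hl)
      · have hsu : s <+: u := List.prefix_of_prefix_length_le hst
          ((List.prefix_append _ _).trans hut) (by simp at hl; omega)
        have h₁ := Nat.find_min' hex ⟨u, hu, hsu, rfl⟩
        have h₂ := hut.length_le
        simp at h₂
        omega
    refine ⟨t, ⟨htN, htR⟩, hst, fun i hi => ⟨htN.2 i hi, fun u hu j huj => ?_⟩⟩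
    rcases List.prefix_concat_iff.mp huj with heq | hpre
    · have := List.append_inj' heq rfl
      simp at this
      exact this.2 ▸ hi
    · exact htR u hu j hpre

theorem inPerp_treeIdeal {n : ℕ} {b : Set (List (Fin n))} {i : Fin n}
    (h : ∀ u ∈ b, ∀ t ∈ b, ¬ u ++ [i] <+: t) : InPerp b (treeIdeal n i) := by
  intro y hy
  rw [Set.inter_comm]
  refine GenIdeal.inter_finite hy ?_
  rintro _ ⟨x, rfl⟩
  refine Set.Subsingleton.finite ?_
  rintro u ⟨hux, hub⟩ t ⟨htx, htb⟩
  have hux' : IsInitSeg u x := hux.of_prefix (List.prefix_append _ _)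
  have htx' : IsInitSeg t x := htx.of_prefix (List.prefix_append _ _)
  rcases lt_trichotomy u.length t.length with hl | hl | hl
  · exact (h u hub t htb (hux.prefix_of_length_le htx' (by simpa using hl))).elim
  · exact (hux'.prefix_of_length_le htx' hl.le).eq_of_length hl
  · exact (h t htb u hub (htx.prefix_of_length_le hux' (by simpa using hl))).elim

theorem treeIdeal_isGap (n : ℕ) (hn : 0 < n) : IsGap (treeIdeal n) := by
  have : IsBranching (n := n) Set.univ Set.univ Set.univ :=
    ⟨⟨[], trivial⟩, fun s _ => ⟨s, trivial, List.prefix_refl s, fun _ _ => trivial⟩⟩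
  have := this.multiGap ⟨⟨0, hn⟩, Set.mem_univ _⟩
  simpa [IsGap, Restrict] using this

theorem treeIdeal_isBJigsaw {n : ℕ} {B : Set (Fin n)} (hB : B.Nonempty) :
    IsBJigsaw (treeIdeal n) B := by
  intro A hBA a ha
  obtain ⟨S, hnil, hS⟩ := exists_isBranching_of_multiGap hBA hB ha
  obtain ⟨b, hba, ⟨S', hS'⟩, hb⟩ := hS.exists_subset hnil
  exact ⟨b, hba, hS'.multiGap hB, fun i hi =>
    inPerp_treeIdeal fun u hu t ht hut => hi.2 (hb u hu t ht i hut)⟩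

/-- The `n`-gap `{J_i : i < n}` on the `n`-ary tree `T = n^{<ω}` is a jigsaw:
a `B`-jigsaw for every nonempty proper subset `B` of `n`. -/
theorem treeIdeals_jigsaw (n : ℕ) (hn : 2 ≤ n) :
    IsGap (treeIdeal n) ∧
    ∀ B : Set (Fin n), B.Nonempty → B ≠ Set.univ → IsBJigsaw (treeIdeal n) B := by
  exact ⟨treeIdeal_isGap n (by omega), fun _ hB _ => treeIdeal_isBJigsaw hB⟩
end

section
/- Analytic multiple gap dichotomy: let {I_i : i < n} be ideals on ω, each analytic as a subset of the Cantor space 2^ω (identifying P(ω) with 2^ω), which together form an n-gap in P(ω)/fin. Then either (1) the ideals are weakly countably separated, or (2) there exists an injective function u : n^{<ω} → ω such that for every i < n and every branch x ∈ n^ω, the image u(a_x^i) = {u(s) : s ∈ a_x^i} belongs to I_i (hence u maps the tree ideal J_i into I_i). -/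
section SigmaSmall

variable {Z ι : Type*} {P : ι → ℕ → Set Z}

/-- `S` is small for the family `P` if only finitely many `m` have the property that `S` meets
`P i m` for every `i`. -/
def IsSmall (P : ι → ℕ → Set Z) (S : Set Z) : Prop :=
  (⋂ i, {m | (S ∩ P i m).Nonempty}).Finite

/-- `U` is covered by countably many small sets. -/
def IsSigmaSmall (P : ι → ℕ → Set Z) (U : Set Z) : Prop :=
  ∃ C : Set (Set Z), C.Countable ∧ (∀ S ∈ C, IsSmall P S) ∧ U ⊆ ⋃₀ C

lemma IsSigmaSmall.nonempty_of_not {U : Set Z} (hU : ¬ IsSigmaSmall P U) : U.Nonempty := by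
  rw [Set.nonempty_iff_ne_empty]
  rintro rfl
  exact hU ⟨∅, Set.countable_empty, by simp, by simp⟩

lemma IsSmall.isSigmaSmall {U : Set Z} (hU : IsSmall P U) : IsSigmaSmall P U :=
  ⟨{U}, Set.countable_singleton U, by simpa using hU, by simp⟩

lemma IsSigmaSmall.mono {U V : Set Z} (hV : IsSigmaSmall P V) (h : U ⊆ V) :
    IsSigmaSmall P U := by
  obtain ⟨C, hC, hS, hVC⟩ := hV
  exact ⟨C, hC, hS, h.trans hVC⟩

lemma IsSigmaSmall.sUnion {T : Set (Set Z)} (hT : T.Countable)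
    (h : ∀ U ∈ T, IsSigmaSmall P U) : IsSigmaSmall P (⋃₀ T) := by
  choose! C hC hS hUC using h
  refine ⟨⋃ U ∈ T, C U, hT.biUnion hC, ?_, ?_⟩
  · simp only [Set.mem_iUnion]
    rintro S ⟨U, hU, hSU⟩
    exact hS U hU S hSU
  · rintro z ⟨U, hU, hz⟩
    obtain ⟨S, hSC, hzS⟩ := hUC U hU hz
    exact ⟨S, Set.mem_biUnion hU hSC, hzS⟩

lemma IsSigmaSmall.union {U V : Set Z} (hU : IsSigmaSmall P U) (hV : IsSigmaSmall P V) :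
    IsSigmaSmall P (U ∪ V) := by
  rw [← Set.sUnion_pair]
  refine IsSigmaSmall.sUnion (by simp) ?_
  rintro W (rfl | rfl)
  exacts [hU, hV]

/-- In a second countable space, if `U` is not `σ`-small then there are arbitrarily many `m` such
that every `P i m` contains a point of `U` all of whose neighbourhoods fail to be `σ`-small. -/
lemma exists_points_of_not_isSigmaSmall [TopologicalSpace Z] [SecondCountableTopology Z]
    {U : Set Z} (hU : ¬ IsSigmaSmall P U) {F : Set ℕ} (hF : F.Finite) :
    ∃ m ∉ F, ∀ i, ∃ z ∈ U ∩ P i m, ∀ W, IsOpen W → z ∈ W → ¬ IsSigmaSmall P W := by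
  set S : Set (Set Z) := {W | IsOpen W ∧ IsSigmaSmall P W} with hS
  obtain ⟨T, hTc, hTS, hT⟩ := TopologicalSpace.isOpen_sUnion_countable S fun _ h => h.1
  have hSS : IsSigmaSmall P (⋃₀ S) := hT ▸ IsSigmaSmall.sUnion hTc fun W hW => (hTS hW).2
  have hbig : ¬ IsSmall P (U \ ⋃₀ S) := fun h =>
    hU ((h.isSigmaSmall.union hSS).mono (by simp))
  obtain ⟨m, hm, hmF⟩ := (Set.not_finite.1 hbig).exists_notMem_finite hF
  refine ⟨m, hmF, fun i => ?_⟩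
  obtain ⟨z, hz, hzP⟩ := Set.mem_iInter.1 hm i
  exact ⟨z, ⟨hz.1, hzP⟩, fun W hW hzW hWs => hz.2 ⟨W, ⟨hW, hWs⟩, hzW⟩⟩

lemma exists_open_refinement [MetricSpace Z] [SecondCountableTopology Z]
    (hP : ∀ i m, IsOpen (P i m)) {U : Set Z} (hUo : IsOpen U) (hU : ¬ IsSigmaSmall P U)
    {F : Set ℕ} (hF : F.Finite) {ε : ℝ} (hε : 0 < ε) :
    ∃ m ∉ F, ∃ V : ι → {V : Set Z // IsOpen V ∧ ¬ IsSigmaSmall P V}, ∀ i,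
      closure (V i : Set Z) ⊆ U ∧ (V i : Set Z) ⊆ P i m ∧
        ∃ z, (V i : Set Z) ⊆ Metric.ball z ε := by
  obtain ⟨m, hm, h⟩ := exists_points_of_not_isSigmaSmall hU hF
  refine ⟨m, hm, ?_⟩
  choose z hz hW using h
  have key : ∀ i, ∃ r > 0, Metric.closedBall (z i) r ⊆ U ∩ P i m := fun i =>
    Metric.nhds_basis_closedBall.mem_iff.1 ((hUo.inter (hP i m)).mem_nhds (hz i))
  choose r hr hrU using key
  refine ⟨fun i => ⟨Metric.ball (z i) (min (r i) ε), Metric.isOpen_ball,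
    hW i _ Metric.isOpen_ball (Metric.mem_ball_self (lt_min (hr i) hε))⟩, fun i => ⟨?_, ?_, ?_⟩⟩
  · exact Metric.closure_ball_subset_closedBall.trans
      ((Metric.closedBall_subset_closedBall (min_le_left _ _)).trans
        ((hrU i).trans Set.inter_subset_left))
  · exact Metric.ball_subset_closedBall.trans
      ((Metric.closedBall_subset_closedBall (min_le_left _ _)).trans
        ((hrU i).trans Set.inter_subset_right))
  · exact ⟨z i, Metric.ball_subset_ball (min_le_right _ _)⟩

/-- Recursion along codes of lists: the value at `i :: l` may depend on the value at `l`, and the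
labels `m` can be kept pairwise distinct. -/
lemma exists_injective_labelling {N : Type*} [Encodable ι] (root : N)
    (R : ℕ → N → ℕ → (ι → N) → Prop)
    (step : ∀ (k : ℕ) (a : N) (F : Set ℕ), F.Finite → ∃ m ∉ F, ∃ b, R k a m b) :
    ∃ (u : List ι → ℕ) (A : List ι → N), Function.Injective u ∧ A [] = root ∧
      ∀ l, R l.length (A l) (u l) fun i => A (i :: l) := by
  have step' : ∀ (k : ℕ) (a : N) (F : Set ℕ), ∃ d : ℕ × (ι → N),
      F.Finite → d.1 ∉ F ∧ R k a d.1 d.2 := by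
    intro k a F
    by_cases hF : F.Finite
    · obtain ⟨m, hm, b, hb⟩ := step k a F hF
      exact ⟨(m, b), fun _ => ⟨hm, hb⟩⟩
    · exact ⟨(0, fun _ => a), fun h => absurd h hF⟩
  choose next hnext using step'
  let G : (s : List ι) →
      ((t : List ι) → Encodable.encode t < Encodable.encode s → ℕ × (ι → N)) →
      ℕ × (ι → N) := fun s =>
    match s with
    | [] => fun rec => next 0 root {m | ∃ t h, m = (rec t h).1}
    | i :: l => fun rec => next (l.length + 1)
        ((rec l (Encodable.encode_list_cons i l ▸
          Nat.lt_succ_of_le (Nat.right_le_pair _ _))).2 i) {m | ∃ t h, m = (rec t h).1}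
  have wf : WellFounded fun s t : List ι => Encodable.encode s < Encodable.encode t :=
    (measure (Encodable.encode : List ι → ℕ)).wf
  let D := wf.fix G
  have hD : ∀ s, D s = G s fun t _ => D t := fun s => wf.fix_eq G s
  have hfin : ∀ s : List ι,
      {m | ∃ t, ∃ _ : Encodable.encode t < Encodable.encode s, m = (D t).1}.Finite := by
    intro s
    have : {t : List ι | Encodable.encode t < Encodable.encode s}.Finite :=
      (Set.finite_Iio (Encodable.encode s)).preimage Encodable.encode_injective.injOn
    refine (this.image fun t => (D t).1).subset ?_
    rintro m ⟨t, h, rfl⟩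
    exact ⟨t, h, rfl⟩
  let A : List ι → N := fun s =>
    match s with
    | [] => root
    | i :: l => (D l).2 i
  have hA : ∀ s, D s = next s.length (A s)
      {m | ∃ t, ∃ _ : Encodable.encode t < Encodable.encode s, m = (D t).1} := by
    intro s
    rw [hD s]
    cases s <;> rfl
  have hspec := fun s => hnext s.length (A s) _ (hfin s)
  simp only [← hA] at hspec
  refine ⟨fun s => (D s).1, A, ?_, rfl, fun l => (hspec l).2⟩
  intro s t hst
  rcases lt_trichotomy (Encodable.encode s) (Encodable.encode t) with h | h | h
  · exact absurd ⟨s, h, hst.symm⟩ (hspec t).1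
  · exact Encodable.encode_injective h
  · exact absurd ⟨t, h, hst⟩ (hspec s).1

/-- If a Polish space is not `σ`-small for open sets `P i m`, then there is an injective labelling
of the tree of finite sequences such that each branch `x` has a point lying in
`P (x k) m` whenever `m` labels the initial segment of `x` of length `k`. -/
lemma exists_tree_of_not_isSigmaSmall [TopologicalSpace Z] [PolishSpace Z] [Encodable ι]
    (hP : ∀ i m, IsOpen (P i m)) (hZ : ¬ IsSigmaSmall P Set.univ) :
    ∃ u : List ι → ℕ, Function.Injective u ∧
      ∀ x : ℕ → ι, ∃ z, ∀ k, z ∈ P (x k) (u (PiNat.res x k)) := by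
  let := TopologicalSpace.upgradeIsCompletelyMetrizable Z
  obtain ⟨u, A, hu, -, hA⟩ := exists_injective_labelling (ι := ι)
    (N := {V : Set Z // IsOpen V ∧ ¬ IsSigmaSmall P V}) ⟨Set.univ, isOpen_univ, hZ⟩
    (fun k U m V => ∀ i, closure (V i : Set Z) ⊆ U ∧ (V i : Set Z) ⊆ P i m ∧
      ∃ z, (V i : Set Z) ⊆ Metric.ball z ((1 / 2 : ℝ) ^ k))
    (fun k U F hF => exists_open_refinement hP U.2.1 U.2.2 hF (by positivity))
  let B : List ι → Set Z := fun l => A l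
  have hanti : CantorScheme.ClosureAntitone B := fun l i => (hA l i).1
  have hdiam : CantorScheme.VanishingDiam B := by
    intro x
    rw [← Filter.tendsto_add_atTop_iff_nat 1]
    have hlim : Filter.Tendsto (fun k : ℕ => ENNReal.ofReal (2 * (1 / 2 : ℝ) ^ k))
        Filter.atTop (nhds 0) := by
      rw [← ENNReal.ofReal_zero]
      refine ENNReal.tendsto_ofReal ?_
      simpa using (tendsto_pow_atTop_nhds_zero_of_lt_one (r := (1 / 2 : ℝ))
        (by norm_num) (by norm_num)).const_mul 2
    refine tendsto_of_tendsto_of_tendsto_of_le_of_le tendsto_const_nhds hlim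
      (fun _ => zero_le) fun k => ?_
    obtain ⟨z, hz⟩ := (hA (PiNat.res x k) (x k)).2.2
    rw [PiNat.res_length] at hz
    refine (Metric.ediam_mono hz).trans ?_
    rw [← Metric.eball_ofReal]
    refine Metric.ediam_eball_le.trans ?_
    rw [ENNReal.ofReal_mul (by norm_num)]
    simp
  have hdom := hanti.map_of_vanishingDiam hdiam
    fun l => IsSigmaSmall.nonempty_of_not (A l).2.2
  refine ⟨u, hu, fun x => ⟨(CantorScheme.inducedMap B).2 ⟨x, hdom ▸ Set.mem_univ x⟩,
    fun k => ?_⟩⟩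
  have := CantorScheme.map_mem (A := B) ⟨x, hdom ▸ Set.mem_univ x⟩ (k + 1)
  exact (hA (PiNat.res x k) (x k)).2.1 this

end SigmaSmall

lemma reverse_eq_res_of_mem_sideSet {n : ℕ} {x : ℕ → Fin n} {i : Fin n} {s : List (Fin n)}
    (hs : s ∈ sideSet x i) : s.reverse = PiNat.res x s.length ∧ i = x s.length := by
  constructor
  · rw [List.reverse_eq_iff]
    refine List.ext_getElem (by simp) fun k hk _ => ?_
    have h := hs k (by simp; omega)
    simp only [List.get_eq_getElem, List.getElem_append_left hk] at h
    rw [h]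
    have hres : ∀ (m k : ℕ) (h : k < (PiNat.res x m).reverse.length),
        (PiNat.res x m).reverse[k] = x k := by
      intro m
      induction m with
      | zero => simp
      | succ m ih =>
        intro k h
        simp only [PiNat.res_succ, List.reverse_cons, List.length_append, List.length_reverse,
          PiNat.res_length, List.length_singleton] at h ⊢
        rcases Nat.lt_succ_iff_lt_or_eq.1 h with h | rfl
        · rw [List.getElem_append_left (by simpa using h)]
          exact ih k _
        · simp [List.getElem_append_right]
    exact (hres _ _ _).symm
  · have h := hs s.length (by simp)
    simpa using h

/-- Analytic multiple gap dichotomy: analytic ideals `{I_i : i < n}` forming an `n`-gap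
in `P(ω)/fin` are either weakly countably separated or contain an injective copy of the
tree gap `{J_i : i < n}`. Analyticity of `I i` is expressed via the identification of
`P(ω)` with the Cantor space `ℕ → Bool`. -/
theorem analytic_multiple_gap_dichotomy (n : ℕ) (I : Fin n → Set (Set ℕ))
    (hIdeal : ∀ i, IsIdeal (I i))
    (hAnalytic : ∀ i, MeasureTheory.AnalyticSet {f : ℕ → Bool | {m : ℕ | f m = true} ∈ I i})
    (hgap : IsGap I) :
    WeaklyCS I ∨
      ∃ u : List (Fin n) → ℕ, Function.Injective u ∧
        ∀ i : Fin n, ∀ x : ℕ → Fin n, u '' sideSet x i ∈ I i := by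
  have hparam : ∀ i, ∃ f : (ℕ → ℕ) → ℕ → Bool, Continuous f ∧
      Set.range f = {f : ℕ → Bool | {m : ℕ | f m = true} ∈ I i} := by
    intro i
    have h := hAnalytic i
    rw [MeasureTheory.AnalyticSet] at h
    refine h.resolve_left (Set.Nonempty.ne_empty ⟨fun _ => false, ?_⟩)
    exact (hIdeal i).1 _ (by simp)
  choose f hf hrange using hparam
  let P : Fin n → ℕ → Set (Fin n → ℕ → ℕ) := fun i m => {z | f i (z i) m = true}
  have hP : ∀ i m, IsOpen (P i m) := fun i m =>
    (isOpen_discrete {true}).preimage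
      ((continuous_apply m).comp ((hf i).comp (continuous_apply i)))
  by_cases hZ : IsSigmaSmall P Set.univ
  · left
    obtain ⟨C, hC, hsmall, hcover⟩ := hZ
    have hne : C.Nonempty := by
      obtain ⟨S, hS, -⟩ := hcover (Set.mem_univ fun _ _ => 0)
      exact ⟨S, hS⟩
    obtain ⟨S, rfl⟩ := hC.exists_eq_range hne
    refine ⟨fun i k => {m | (S k ∩ P i m).Nonempty}, fun k => hsmall _ ⟨k, rfl⟩, ?_⟩
    intro x hx
    have hz : ∀ i, ∃ z, {m | f i z m = true} = x i := by
      classical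
      intro i
      have : (fun m => decide (m ∈ x i)) ∈ Set.range (f i) := by
        rw [hrange i]
        simpa using hx i
      obtain ⟨z, hz⟩ := this
      exact ⟨z, by simp [hz]⟩
    choose z hz using hz
    obtain ⟨_, ⟨k, rfl⟩, hk⟩ := hcover (Set.mem_univ z)
    refine ⟨k, fun i => ?_⟩
    rw [Set.sdiff_eq_empty.2]
    · exact Set.finite_empty
    · intro m hm
      rw [← hz i] at hm
      exact ⟨z, hk, hm⟩
  · right
    obtain ⟨u, hu, h⟩ := exists_tree_of_not_isSigmaSmall hP hZ
    refine ⟨fun s => u s.reverse, hu.comp List.reverse_injective, fun i x => ?_⟩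
    obtain ⟨z, hz⟩ := h x
    have hmem : f i (z i) ∈ Set.range (f i) := ⟨_, rfl⟩
    rw [hrange i] at hmem
    refine (hIdeal i).2.2 _ hmem _ ?_
    rintro _ ⟨s, hs, rfl⟩
    obtain ⟨h1, rfl⟩ := reverse_eq_res_of_mem_sideSet hs
    change f _ _ (u s.reverse) = true
    rw [h1]
    exact hz s.length
end

section
/- Let {I_i : i < n} be ideals on ω and let 𝔛 be a family of subsets of n. Then the following are equivalent: (1) the ideals {I_i : i < n} are 𝔛-countably separated; (2) there exist a compact metric space L, a countable subset D ⊆ L, a bijection f : ω → D, and sets G_i ⊆ K = acc(D) for i < n, such that ⋂_{i∈A} G_i = ∅ for every A ∈ 𝔛, and for every i < n and every x ∈ I_i the image f(x) = {f(m) : m ∈ x} satisfies acc(f(x)) ⊆ G_i (that is, f maps I_i into the ideal I_{G_i}). -/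
/-- `𝔛`-countable separation of ideals on `ω`. -/
def XCountSep {n : ℕ} (𝔛 : Set (Set (Fin n))) (I : Fin n → Set (Set ℕ)) : Prop :=
  ∃ c : Fin n → ℕ → Set ℕ,
    (∀ k, ∀ A ∈ 𝔛, (⋂ i ∈ A, c i k).Finite) ∧
    ∀ x : Fin n → Set ℕ, (∀ i, x i ∈ I i) → ∃ k, ∀ i, (x i \ c i k).Finite

/-- The set of accumulation points of a subset of a metric space: points every
neighbourhood of which meets the set in infinitely many points. -/
def accPts {L : Type*} [MetricSpace L] (a : Set L) : Set L :=
  {x | ∀ ε : ℝ, 0 < ε → (Metric.ball x ε ∩ a).Infinite}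

/-- The witness for condition (2) of the characterization of `𝔛`-countable separation:
`L` is a compact metric space, `D ⊆ L` a countable subset, `f : ω → D` a bijection, and
`G_i ⊆ K = acc(D)` sets with empty `𝔛`-intersections such that `f` maps each `I_i`
into the ideal `I_{G_i} = {a ⊆ D : acc(a) ⊆ G_i}`. -/
def MetricWitness {n : ℕ} (𝔛 : Set (Set (Fin n))) (I : Fin n → Set (Set ℕ))
    (L : Type) [MetricSpace L] : Prop :=
  CompactSpace L ∧
    ∃ D : Set L, D.Countable ∧
      ∃ f : ℕ → L, Function.Injective f ∧ Set.range f = D ∧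
        ∃ G : Fin n → Set L,
          (∀ i, G i ⊆ accPts D) ∧
          (∀ A ∈ 𝔛, ⋂ i ∈ A, G i = ∅) ∧
          ∀ i, ∀ x ∈ I i, accPts (f '' x) ⊆ G i

open Set Filter Topology TopologicalSpace Metric

theorem AccPt.infinite_inter {X : Type*} [TopologicalSpace X] [T1Space X] {x : X} {a U : Set X}
    (h : AccPt x (𝓟 a)) (hU : U ∈ 𝓝 x) : (U ∩ a).Infinite :=
  .of_accPt (h.nhds_inter hU)

theorem accPts_eq_derivedSet {L : Type*} [MetricSpace L] (a : Set L) :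
    accPts a = derivedSet a := by
  ext x
  rw [mem_derivedSet]
  refine ⟨fun h => accPt_iff_nhds.2 fun U hU => ?_,
    fun h ε hε => h.infinite_inter (ball_mem_nhds x hε)⟩
  obtain ⟨ε, hε, hsub⟩ := Metric.mem_nhds_iff.1 hU
  obtain ⟨y, hy, hyx⟩ := (h ε hε).exists_notMem_finite (finite_singleton x)
  exact ⟨y, ⟨hsub hy.1, hy.2⟩, hyx⟩

/-- In a second countable space, countably many open sets interpolate between all pairs of a
compact set and an open neighbourhood of it. -/
theorem exists_countable_open_interpolating (X : Type*) [TopologicalSpace X]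
    [SecondCountableTopology X] :
    ∃ T : Set (Set X), T.Countable ∧ (∀ U ∈ T, IsOpen U) ∧
      ∀ K V : Set X, IsCompact K → IsOpen V → K ⊆ V → ∃ U ∈ T, K ⊆ U ∧ U ⊆ V := by
  refine ⟨sUnion '' {t | t.Finite ∧ t ⊆ countableBasis X},
    (countable_ofPred_finite_subset (countable_countableBasis X)).image _, ?_, ?_⟩
  · rintro _ ⟨t, ⟨-, ht⟩, rfl⟩
    exact isOpen_sUnion fun b hb => isOpen_of_mem_countableBasis (ht hb)
  · intro K V hK hV hKV
    obtain ⟨t, ht, hfin, hcov⟩ := hK.elim_finite_subcover_image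
      (b := {b | b ∈ countableBasis X ∧ b ⊆ V}) (c := id)
      (fun b hb => isOpen_of_mem_countableBasis hb.1) fun x hx => by
        obtain ⟨b, hb, hxb, hbV⟩ :=
          (isBasis_countableBasis X).exists_subset_of_mem_open (hKV hx) hV
        exact mem_biUnion (show b ∈ {b | b ∈ countableBasis X ∧ b ⊆ V} from ⟨hb, hbV⟩) hxb
    refine ⟨⋃₀ t, ⟨t, ⟨hfin, fun b hb => (ht hb).1⟩, rfl⟩, ?_, sUnion_subset fun b hb => (ht hb).2⟩
    rwa [sUnion_eq_biUnion]

/-- Finitely many closed sets in a compact space have thickenings realizing no new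
nonempty intersections. -/
theorem exists_thickening_biInter_eq_empty {L ι : Type*} [MetricSpace L] [CompactSpace L]
    [Finite ι] {K : ι → Set L} (hK : ∀ i, IsClosed (K i)) {𝔛 : Set (Set ι)}
    (h : ∀ A ∈ 𝔛, ⋂ i ∈ A, K i = ∅) :
    ∃ δ > 0, ∀ A ∈ 𝔛, ⋂ i ∈ A, thickening δ (K i) = ∅ := by
  have key : ∀ A : Set ι, ∀ᶠ δ in 𝓝[>] (0 : ℝ), A ∈ 𝔛 → ⋂ i ∈ A, thickening δ (K i) = ∅ := by
    intro A
    by_cases hA : A ∈ 𝔛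
    swap
    · exact .of_forall fun _ hA' => absurd hA' hA
    have : Nonempty (Ioi (0 : ℝ)) := ⟨⟨1, mem_Ioi.2 one_pos⟩⟩
    obtain ⟨⟨δ, hδ⟩, hempty⟩ := isCompact_univ.elim_directed_family_closed
      (fun δ : Ioi (0 : ℝ) => ⋂ i ∈ A, cthickening δ (K i))
      (fun _ => isClosed_biInter fun _ _ => isClosed_cthickening)
      (by
        rw [univ_inter, ← subset_empty_iff, ← h A hA]
        refine fun x hx => mem_iInter₂.2 fun i hi => ?_
        rw [← (hK i).closure_eq, closure_eq_iInter_cthickening]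
        exact mem_iInter₂.2 fun δ hδ => mem_iInter₂.1 (mem_iInter.1 hx ⟨δ, hδ⟩) i hi)
      (Monotone.directed_ge fun δ₁ δ₂ hle =>
        biInter_mono subset_rfl fun i _ => cthickening_mono hle (K i))
    filter_upwards [Ioo_mem_nhdsGT hδ] with η hη _
    rw [univ_inter] at hempty
    rw [← subset_empty_iff, ← hempty]
    exact biInter_mono subset_rfl fun i _ =>
      (thickening_subset_cthickening η _).trans (cthickening_mono hη.2.le _)
  obtain ⟨δ, hδ, hδ0⟩ := ((eventually_all.2 key).and self_mem_nhdsWithin).exists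
  exact ⟨δ, hδ0, hδ⟩

theorem finite_diff_preimage_of_derivedSet_subset {E L : Type*} [TopologicalSpace L]
    [CompactSpace L] {f : E → L} (hf : Function.Injective f) {x : Set E} {U : Set L}
    (hU : IsOpen U) (h : derivedSet (f '' x) ⊆ U) : (x \ f ⁻¹' U).Finite := by
  by_contra hinf
  obtain ⟨y, hy⟩ := (Set.Infinite.image hf.injOn hinf).exists_accPt_principal
  have hyU : y ∈ U := h (hy.mono (principal_mono.2 (image_mono sdiff_subset)))
  obtain ⟨_, ⟨hzU, m, hm, rfl⟩, -⟩ := accPt_iff_nhds.1 hy U (hU.mem_nhds hyU)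
  exact hm.2 hzU

theorem XCountSep.of_metricWitness {n : ℕ} {𝔛 : Set (Set (Fin n))} {I : Fin n → Set (Set ℕ)}
    (hI : ∀ i, (∅ : Set ℕ) ∈ I i) {L : Type} [MetricSpace L] (h : MetricWitness 𝔛 I L) :
    XCountSep 𝔛 I := by
  obtain ⟨_, D, -, f, hf, -, G, -, hG, hIG⟩ := h
  obtain ⟨T, hT, hTo, hTs⟩ := exists_countable_open_interpolating L
  have : Countable T := hT
  let S : Set (Fin n → Set ℕ) :=
    range (fun (U : Fin n → T) i => f ⁻¹' (U i : Set L)) ∩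
      {c | ∀ A ∈ 𝔛, (⋂ i ∈ A, c i).Finite}
  have hS : ∀ x : Fin n → Set ℕ, (∀ i, x i ∈ I i) → ∃ c ∈ S, ∀ i, (x i \ c i).Finite := by
    intro x hx
    have hcl : ∀ i, IsClosed (derivedSet (f '' x i)) := fun i => isClosed_derivedSet _
    obtain ⟨δ, hδ, hempty⟩ := exists_thickening_biInter_eq_empty hcl (𝔛 := 𝔛) fun A hA => by
      rw [← subset_empty_iff, ← hG A hA]
      exact biInter_mono subset_rfl fun i _ => accPts_eq_derivedSet (f '' x i) ▸ hIG i _ (hx i)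
    choose U hUT hKU hUV using fun i => hTs _ _ (hcl i).isCompact isOpen_thickening
      (self_subset_thickening hδ (derivedSet (f '' x i)))
    refine ⟨fun i => f ⁻¹' U i, ⟨⟨fun i => ⟨U i, hUT i⟩, rfl⟩, fun A hA => ?_⟩,
      fun i => finite_diff_preimage_of_derivedSet_subset hf (hTo _ (hUT i)) (hKU i)⟩
    have hsub : ⋂ i ∈ A, U i ⊆ ∅ := hempty A hA ▸ biInter_mono subset_rfl fun i _ => hUV i
    simp [← preimage_iInter₂, subset_empty_iff.1 hsub]
  obtain ⟨c₀, hc₀, -⟩ := hS (fun _ => ∅) hI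
  obtain ⟨c, hc⟩ := ((countable_range _).mono inter_subset_left).exists_eq_range
    (⟨c₀, hc₀⟩ : S.Nonempty)
  refine ⟨fun i k => c k i, fun k => ?_, fun x hx => ?_⟩
  · exact (show c k ∈ S from hc.symm.subset (mem_range_self k)).2
  · obtain ⟨_, hmem, hfin⟩ := hS x hx
    obtain ⟨k, rfl⟩ := hc.subset hmem
    exact ⟨k, hfin⟩

open Classical in
/-- The embedding of `ℕ` into a Cantor cube that records membership in each `c i k`. -/
noncomputable def cubeEmbedding {ι : Type*} (c : ι → ℕ → Set ℕ) (m : ℕ) : ι × ℕ ⊕ ℕ → Bool :=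
  Sum.elim (fun p => decide (m ∈ c p.1 p.2)) (fun j => decide (m = j))

theorem cubeEmbedding_injective {ι : Type*} (c : ι → ℕ → Set ℕ) :
    Function.Injective (cubeEmbedding c) := fun m m' h => by
  have := congrFun h (Sum.inr m')
  simpa [cubeEmbedding] using this

theorem cubeEmbedding_inl {ι : Type*} (c : ι → ℕ → Set ℕ) (m : ℕ) (i : ι) (k : ℕ) :
    cubeEmbedding c m (Sum.inl (i, k)) = true ↔ m ∈ c i k := by
  simp [cubeEmbedding]

theorem isOpen_setOf_apply_eq {κ : Type*} (p : κ) (b : Bool) :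
    IsOpen {z : κ → Bool | z p = b} :=
  (isOpen_discrete {b}).preimage (continuous_apply (A := fun _ : κ => Bool) p)

theorem apply_inl_of_accPt_cubeEmbedding {ι : Type*} {c : ι → ℕ → Set ℕ} {x : Set ℕ}
    {y : ι × ℕ ⊕ ℕ → Bool} (hy : AccPt y (𝓟 (cubeEmbedding c '' x))) {i : ι} {k : ℕ}
    (hx : (x \ c i k).Finite) : y (Sum.inl (i, k)) = true := by
  by_contra hne
  refine hy.infinite_inter ((isOpen_setOf_apply_eq (Sum.inl (i, k)) false).mem_nhds
    (Bool.eq_false_iff.2 hne)) ((hx.image (cubeEmbedding c)).subset ?_)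
  rintro _ ⟨hz, m, hm, rfl⟩
  refine ⟨m, ⟨hm, fun hmc => ?_⟩, rfl⟩
  have := (cubeEmbedding_inl c m i k).2 hmc
  simp_all

theorem XCountSep.exists_metricWitness {n : ℕ} {𝔛 : Set (Set (Fin n))}
    {I : Fin n → Set (Set ℕ)} (hI : ∀ i, (∅ : Set ℕ) ∈ I i) (h : XCountSep 𝔛 I) :
    ∃ (L : Type) (m : MetricSpace L), @MetricWitness n 𝔛 I L m := by
  obtain ⟨c, hc, hsep⟩ := h
  let _ : MetricSpace (Fin n × ℕ ⊕ ℕ → Bool) := metrizableSpaceMetric _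
  refine ⟨Fin n × ℕ ⊕ ℕ → Bool, inferInstance, inferInstance, range (cubeEmbedding c),
    countable_range _, cubeEmbedding c, cubeEmbedding_injective c, rfl,
    fun i => ⋃ x ∈ I i, derivedSet (cubeEmbedding c '' x), ?_, ?_, ?_⟩
  · intro i
    rw [accPts_eq_derivedSet]
    exact iUnion₂_subset fun x _ => derivedSet_mono _ _ (image_subset_range _ _)
  · refine fun A hA => eq_empty_of_forall_notMem fun y hy => ?_
    have hex : ∀ i, ∃ x ∈ I i, i ∈ A → AccPt y (𝓟 (cubeEmbedding c '' x)) := fun i => by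
      by_cases hi : i ∈ A
      · obtain ⟨x, hx, hyx⟩ := mem_iUnion₂.1 (mem_iInter₂.1 hy i hi)
        exact ⟨x, hx, fun _ => hyx⟩
      · exact ⟨∅, hI i, fun h => absurd h hi⟩
    choose x hx hyx using hex
    obtain ⟨k, hk⟩ := hsep x hx
    rcases A.eq_empty_or_nonempty with rfl | ⟨i₀, hi₀⟩
    · exact infinite_univ (by simpa using hc k ∅ hA)
    have hU : ⋂ i ∈ A, {z : Fin n × ℕ ⊕ ℕ → Bool | z (Sum.inl (i, k)) = true} ∈ 𝓝 y :=
      (biInter_mem A.toFinite).2 fun i hi => (isOpen_setOf_apply_eq _ _).mem_nhds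
        (apply_inl_of_accPt_cubeEmbedding (hyx i hi) (hk i))
    refine (hyx i₀ hi₀).infinite_inter hU (((hc k A hA).image (cubeEmbedding c)).subset ?_)
    rintro _ ⟨hz, m, -, rfl⟩
    exact ⟨m, mem_iInter₂.2 fun i hi =>
      (cubeEmbedding_inl c m i k).1 (mem_iInter₂.1 hz i hi), rfl⟩
  · intro i x hx
    rw [accPts_eq_derivedSet]
    exact subset_biUnion_of_mem (u := fun x => derivedSet (cubeEmbedding c '' x)) hx

/-- Characterization of `𝔛`-countable separation: ideals `{I_i : i < n}` on `ω` are
`𝔛`-countably separated iff they embed into ideals of the form `I_{G_i}` on a countable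
subset of a compact metric space, with `⋂_{i ∈ A} G_i = ∅` for every `A ∈ 𝔛`. -/
theorem xCountSep_iff_metricWitness (n : ℕ) (𝔛 : Set (Set (Fin n)))
    (I : Fin n → Set (Set ℕ)) (hIdeal : ∀ i, IsIdeal (I i)) :
    XCountSep 𝔛 I ↔ ∃ (L : Type) (m : MetricSpace L), @MetricWitness n 𝔛 I L m := by
  have hempty : ∀ i, (∅ : Set ℕ) ∈ I i := fun i => (hIdeal i).1 ∅ Set.finite_empty
  exact ⟨XCountSep.exists_metricWitness hempty, fun ⟨_, _, h⟩ => .of_metricWitness hempty h⟩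
end

section
/- Let L be a compact metric space, D ⊆ L a countable subset, and G a G_δ subset of L. Then the ideal I_G = {a ⊆ D : acc(a) ⊆ G}, viewed as a subset of the Cantor space 2^D of all subsets of D (with the product topology), is an F_σδ set, i.e., a countable intersection of countable unions of closed subsets of 2^D; in particular I_G is Borel. -/
/-- A compact set containing no accumulation point of `a` has an open neighbourhood meeting `a`
in a finite set. -/
lemma exists_isOpen_inter_finite_of_disjoint_accPts {L : Type*} [MetricSpace L] {a K : Set L}
    (hK : IsCompact K) (h : Disjoint (accPts a) K) :
    ∃ V, IsOpen V ∧ K ⊆ V ∧ (V ∩ a).Finite := by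
  refine hK.induction_on (p := fun s => ∃ V, IsOpen V ∧ s ⊆ V ∧ (V ∩ a).Finite)
    ⟨∅, isOpen_empty, subset_rfl, by simp⟩ ?_ ?_ ?_
  · rintro s t hst ⟨V, hV, htV, hfin⟩
    exact ⟨V, hV, hst.trans htV, hfin⟩
  · rintro s t ⟨V, hV, hsV, hVfin⟩ ⟨W, hW, htW, hWfin⟩
    refine ⟨V ∪ W, hV.union hW, Set.union_subset_union hsV htW, ?_⟩
    rw [Set.union_inter_distrib_right]
    exact hVfin.union hWfin
  · intro x hx
    have hxa : x ∉ accPts a := fun hxa => Set.disjoint_left.mp h hxa hx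
    simp only [accPts, Set.mem_ofPred_eq, not_forall, Set.not_infinite] at hxa
    obtain ⟨ε, hε, hfin⟩ := hxa
    exact ⟨Metric.ball x ε, mem_nhdsWithin_of_mem_nhds (Metric.ball_mem_nhds x hε),
      Metric.ball x ε, Metric.isOpen_ball, subset_rfl, hfin⟩

/-- A compact set contains no accumulation point of `a` if and only if one of its thickenings
meets `a` in a finite set. -/
lemma disjoint_accPts_iff_exists_thickening {L : Type*} [MetricSpace L] {a K : Set L}
    (hK : IsCompact K) :
    Disjoint (accPts a) K ↔ ∃ n : ℕ, (Metric.thickening (1 / ((n : ℝ) + 1)) K ∩ a).Finite := by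
  constructor
  · intro h
    obtain ⟨V, hV, hKV, hfin⟩ := exists_isOpen_inter_finite_of_disjoint_accPts hK h
    obtain ⟨δ, hδ, hsub⟩ := hK.exists_thickening_subset_open hV hKV
    obtain ⟨n, hn⟩ := exists_nat_one_div_lt hδ
    exact ⟨n, hfin.subset
      (Set.inter_subset_inter_left a ((Metric.thickening_mono hn.le K).trans hsub))⟩
  · rintro ⟨n, hn⟩
    refine Set.disjoint_left.mpr fun x hxa hxK => ?_
    exact hxa _ Nat.one_div_pos_of_nat
      (hn.subset (Set.inter_subset_inter_left a (Metric.ball_subset_thickening hxK _)))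

/-- The subsets of `D` whose trace on `T` is contained in `F` form a closed subset of `2^D`. -/
lemma isClosed_setOf_trace_subset {ι : Type*} (T F : Set ι) :
    IsClosed {f : ι → Bool | ∀ d ∈ T, f d = true → d ∈ F} := by
  have : {f : ι → Bool | ∀ d ∈ T, f d = true → d ∈ F} =
      ⋂ d ∈ T \ F, {f : ι → Bool | f d = false} := by
    ext f
    simp only [Set.mem_ofPred_eq, Set.mem_iInter, Set.mem_sdiff]
    grind
  rw [this]
  exact isClosed_biInter fun d _ => isClosed_eq (continuous_apply d) continuous_const

/-- If `G` is a `G_δ` subset of a compact metric space `L` and `D ⊆ L` is countable, then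
the ideal `I_G = {a ⊆ D : acc(a) ⊆ G}`, viewed as a subset of the Cantor space `2^D`
(here `↥D → Bool` with the product topology), is `F_σδ`: a countable intersection of
countable unions of closed sets. In particular it is Borel. -/
theorem idealIG_FsigmaDelta
    (L : Type*) [MetricSpace L] [CompactSpace L]
    (D : Set L) (hD : D.Countable) (G : Set L) (hG : IsGδ G) :
    ∃ C : ℕ → ℕ → Set (D → Bool),
      (∀ m k, IsClosed (C m k)) ∧
      {f : D → Bool | accPts (Subtype.val '' {d : D | f d = true}) ⊆ G}
        = ⋂ m, ⋃ k, C m k := by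
  obtain ⟨U, hU, rfl⟩ := isGδ_iff_eq_iInter_nat.mp hG
  have : Countable D := hD.to_subtype
  obtain ⟨e, he⟩ := exists_surjective_nat (ℕ × Finset D)
  refine ⟨fun m k => {f | ∀ d ∈ Subtype.val ⁻¹' Metric.thickening (1 / (((e k).1 : ℝ) + 1)) (U m)ᶜ,
    f d = true → d ∈ ((e k).2 : Set D)}, fun m k => isClosed_setOf_trace_subset _ _, ?_⟩
  ext f
  simp only [Set.mem_ofPred_eq, Set.subset_iInter_iff, Set.mem_iInter, Set.mem_iUnion]
  refine forall_congr' fun m => ?_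
  rw [← Set.disjoint_compl_right_iff_subset,
    disjoint_accPts_iff_exists_thickening (hU m).isClosed_compl.isCompact,
    he.exists (p := fun q : ℕ × Finset D =>
      ∀ d ∈ Subtype.val ⁻¹' Metric.thickening (1 / ((q.1 : ℝ) + 1)) (U m)ᶜ,
        f d = true → d ∈ (q.2 : Set D)) |>.symm, Prod.exists]
  refine exists_congr fun n => ?_
  rw [← Set.image_preimage_inter,
    Set.finite_image_iff Subtype.val_injective.injOn]
  constructor
  · intro h
    exact ⟨h.toFinset, fun d hd hfd => h.mem_toFinset.mpr ⟨hd, hfd⟩⟩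
  · rintro ⟨F, hF⟩
    exact F.finite_toSet.subset fun d hd => hF d hd.1 hd.2
end

section
/- Let L be a compact metric space, Z ⊆ L an arbitrary subset, and {V_i : i < n} relatively open subsets of Z (i.e., V_i = Z ∩ W_i for some open W_i ⊆ L) with ⋂_{i<n} V_i = ∅. Then there exist open subsets {U_i : i < n} of L such that U_i ∩ Z = V_i for every i < n and ⋂_{i<n} U_i = ∅. -/
/-- Relatively open subsets of an arbitrary subset `Z` of a compact metric space with
empty intersection extend to open subsets of the whole space with empty intersection. -/
theorem relatively_open_extension
    (L : Type*) [MetricSpace L] [CompactSpace L]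
    (n : ℕ) (Z : Set L) (V : Fin n → Set L)
    (hV : ∀ i, ∃ W : Set L, IsOpen W ∧ V i = Z ∩ W)
    (hinter : ⋂ i, V i = ∅) :
    ∃ U : Fin n → Set L,
      (∀ i, IsOpen (U i) ∧ U i ∩ Z = V i) ∧ ⋂ i, U i = ∅ := by
  have hVZ (i) : V i ⊆ Z := by
    obtain ⟨W, -, hW⟩ := hV i
    exact hW ▸ Set.inter_subset_left
  refine ⟨fun i => {x | Metric.infEDist x (V i) < Metric.infEDist x (Z \ V i)},
    fun i => ⟨isOpen_lt Metric.continuous_infEDist Metric.continuous_infEDist, ?_⟩, ?_⟩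
  · ext x
    constructor
    · rintro ⟨hx, hxZ⟩
      by_contra hxV
      rw [Set.mem_ofPred_eq, Metric.infEDist_zero_of_mem (s := Z \ V i) ⟨hxZ, hxV⟩] at hx
      exact not_lt_zero hx
    · intro hx
      refine ⟨?_, hVZ i hx⟩
      rw [Set.mem_ofPred_eq, Metric.infEDist_zero_of_mem hx, pos_iff_ne_zero, Ne,
        ← Metric.mem_closure_iff_infEDist_zero]
      obtain ⟨W, hWo, hW⟩ := hV i
      intro hcl
      obtain ⟨y, hyW, hyZ, hyV⟩ := mem_closure_iff.mp hcl W hWo (hW ▸ hx : x ∈ Z ∩ W).2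
      exact hyV (hW ▸ ⟨hyZ, hyW⟩)
  · refine Set.eq_empty_of_forall_notMem fun x hx => ?_
    have hlt (i) : Metric.infEDist x Z < Metric.infEDist x (Z \ V i) :=
      (Metric.infEDist_anti (hVZ i)).trans_lt (Set.mem_iInter.mp hx i)
    have hZ : Z = ⋃ i, Z \ V i := by rw [← Set.sdiff_iInter, hinter, Set.sdiff_empty]
    have : Nonempty (Fin n) := by
      by_contra hn
      rw [not_nonempty_iff] at hn
      rw [Set.iInter_of_empty] at hinter
      exact (hinter ▸ Set.mem_univ x : x ∈ (∅ : Set L))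
    obtain ⟨i, hi⟩ := exists_eq_ciInf_of_finite (f := fun i => Metric.infEDist x (Z \ V i))
    refine (hlt i).ne' (hi.trans ?_)
    rw [← Metric.infEDist_iUnion, ← hZ]
end

section
/- Every strongly countably separated dense n-gap {I_i : i < n} of ideals on ω is a jigsaw, i.e., a B-jigsaw for every nonempty proper subset B of n. -/
/-- A family of ideals is dense if every infinite set contains an infinite member of
some of the ideals. -/
def DenseFam {E : Type*} {n : ℕ} (I : Fin n → Set (Set E)) : Prop :=
  ∀ a : Set E, a.Infinite → ∃ i : Fin n, ∃ x ∈ I i, x ⊆ a ∧ x.Infinite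

/-- The values of `f` along the set `x` converge to `z` (vacuously so if `x` is finite). -/
def ConvAlong {X : Type*} [MetricSpace X] (f : ℕ → X) (x : Set ℕ) (z : X) : Prop :=
  ∀ ε > 0, {m ∈ x | ε ≤ dist (f m) z}.Finite

/-- The limits of `f` along infinite subsets of `a` that belong to `J`. -/
def limitSet {X : Type*} [MetricSpace X] (f : ℕ → X) (J : Set (Set ℕ)) (a : Set ℕ) : Set X :=
  {z | ∃ x ∈ J, x.Infinite ∧ x ⊆ a ∧ ConvAlong f x z}

/-- Iterated limit points: `nestedLimits Z [i₀, i₁, …]` is the set of points of `Z i₀` that are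
limits of points of `Z i₁` that are limits of points of `Z i₂`, and so on. -/
def nestedLimits {X ι : Type*} [TopologicalSpace X] (Z : ι → Set X) : List ι → Set X
  | [] => Set.univ
  | j :: t => Z j ∩ closure (nestedLimits Z t)

section ConvAlong

variable {X : Type*} [MetricSpace X] {f : ℕ → X} {x y : Set ℕ} {z : X}

theorem ConvAlong.mono (h : ConvAlong f x z) (hyx : y ⊆ x) : ConvAlong f y z :=
  fun ε hε => (h ε hε).subset fun _ hm => ⟨hyx hm.1, hm.2⟩

theorem ConvAlong.exists_mem_dist_lt (h : ConvAlong f x z) (hx : x.Infinite) {ε : ℝ}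
    (hε : 0 < ε) : {m ∈ x | dist (f m) z < ε}.Infinite := by
  have := hx.sdiff (h ε hε)
  refine this.mono ?_
  rintro m ⟨hm, hn⟩
  exact ⟨hm, not_le.1 fun hle => hn ⟨hm, hle⟩⟩

theorem exists_convAlong_subset [CompactSpace X] (f : ℕ → X) (hx : x.Infinite) :
    ∃ y ⊆ x, y.Infinite ∧ ∃ z, ConvAlong f y z := by
  let g := hx.natEmbedding
  obtain ⟨z, φ, hφ, hlim⟩ := CompactSpace.tendsto_subseq (fun k => f (g k))
  have hinj : Function.Injective fun k => (g (φ k) : ℕ) :=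
    Subtype.val_injective.comp (g.injective.comp hφ.injective)
  refine ⟨Set.range fun k => (g (φ k) : ℕ), ?_, Set.infinite_range_of_injective hinj, z, ?_⟩
  · rintro _ ⟨k, rfl⟩
    exact (g (φ k)).2
  · intro ε hε
    obtain ⟨N, hN⟩ := Metric.tendsto_atTop.1 hlim ε hε
    refine ((Set.finite_lt_nat N).image fun k => (g (φ k) : ℕ)).subset ?_
    rintro _ ⟨⟨k, rfl⟩, hk⟩
    refine ⟨k, ?_, rfl⟩
    by_contra hlt
    exact absurd (hN k (not_lt.1 hlt)) (not_lt.2 hk)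

/-- If a sequence of sets shrinks to `z` and each meets `x` in a finite set, then `f` converges
to `z` along the part of `x` in their union. -/
theorem convAlong_iUnion_inter {b : ℕ → Set ℕ}
    (hb : ∀ m, ∀ p ∈ b m, dist (f p) z < 1 / ((m : ℝ) + 1))
    (hfin : ∀ m, (b m ∩ x).Finite) : ConvAlong f ((⋃ m, b m) ∩ x) z := by
  intro ε hε
  obtain ⟨N, hN⟩ := exists_nat_one_div_lt hε
  refine ((Set.finite_lt_nat N).biUnion fun m _ => hfin m).subset ?_
  rintro p ⟨⟨hp, hpx⟩, hle⟩
  obtain ⟨m, hm⟩ := Set.mem_iUnion.1 hp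
  refine Set.mem_biUnion (x := m) ?_ ⟨hm, hpx⟩
  by_contra hlt
  have hNm : (N : ℝ) ≤ m := Nat.cast_le.2 (not_lt.1 hlt)
  have : 1 / ((m : ℝ) + 1) ≤ 1 / ((N : ℝ) + 1) :=
    one_div_le_one_div_of_le (by positivity) (by linarith)
  linarith [hb m p hm]

end ConvAlong

section NestedLimits

variable {X ι : Type*}

theorem nestedLimits_subset_closure_filter [TopologicalSpace X] (Z : ι → Set X) (p : ι → Bool)
    (l : List ι) : nestedLimits Z l ⊆ closure (nestedLimits Z (l.filter p)) := by
  induction l with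
  | nil => exact subset_closure
  | cons j t ih =>
    rintro z ⟨hzj, hzt⟩
    have hz := closure_minimal ih isClosed_closure hzt
    by_cases hp : p j = true
    · rw [List.filter_cons_of_pos hp]
      exact subset_closure ⟨hzj, hz⟩
    · rwa [List.filter_cons_of_neg hp]

theorem exists_radius_mem_closure [MetricSpace X] {T : Set (Set X)} (hT : T.Finite) (z : X) :
    ∃ r > 0, ∀ s ∈ T, (∃ q ∈ s, dist q z < 2 * r) → z ∈ closure s := by
  have key : ∀ᶠ r : ℝ in nhdsWithin 0 (Set.Ioi 0),
      ∀ s ∈ T, (∃ q ∈ s, dist q z < 2 * r) → z ∈ closure s := by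
    rw [Filter.eventually_all_finite hT]
    intro s _
    by_cases hz : z ∈ closure s
    · exact Filter.Eventually.of_forall fun _ _ => hz
    · rw [Metric.mem_closure_iff] at hz
      push Not at hz
      obtain ⟨ε, hε, h⟩ := hz
      filter_upwards [Ioo_mem_nhdsGT (half_pos hε)] with r hr
      rintro ⟨q, hq, hqz⟩
      have := h q hq
      rw [dist_comm] at this
      linarith [hr.2]
  obtain ⟨r, hr, h⟩ := (key.and self_mem_nhdsWithin).exists
  exact ⟨r, h, hr⟩

/-- The sets `Z i` have open neighbourhoods (unions of balls) such that if those of `Z i` for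
`i ∈ A` have a common point, there is a nested limit point along some enumeration of `A`. -/
theorem exists_radii_nestedLimits [MetricSpace X] [Fintype ι] (Z : ι → Set X) :
    ∃ r : X → ℝ, (∀ z, 0 < r z) ∧ ∀ (A : Finset ι) (y : X),
      (∀ i ∈ A, ∃ z ∈ Z i, dist y z < r z) →
      ∃ l : List ι, (∀ i, i ∈ l ↔ i ∈ A) ∧ (nestedLimits Z l).Nonempty := by
  classical
  have hT : (nestedLimits Z '' {l | l.length ≤ Fintype.card ι}).Finite :=
    (List.finite_length_le ι _).image _
  choose r hr0 hr using exists_radius_mem_closure hT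
  refine ⟨r, hr0, fun A y hy => ?_⟩
  have : Nonempty X := ⟨y⟩
  choose! z hz hyz using hy
  suffices H : ∀ S : Finset ι, S ⊆ A → ∃ l : List ι, l.length ≤ S.card ∧ (∀ i, i ∈ l ↔ i ∈ S) ∧
      ∃ q ∈ nestedLimits Z l, ∀ ρ > 0, (∀ j ∈ S, r (z j) ≤ ρ) → dist q y < ρ by
    obtain ⟨l, -, hl, q, hq, -⟩ := H A subset_rfl
    exact ⟨l, hl, q, hq⟩
  intro S
  induction S using Finset.induction_on_max_value (fun i => r (z i)) with
  | empty => exact fun _ => ⟨[], by simp, by simp, y, Set.mem_univ _, fun ρ hρ _ => by simpa using hρ⟩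
  | insert a S haS hmax ih =>
    intro hSA
    obtain ⟨l, hlen, hl, q, hq, hqy⟩ := ih ((Finset.subset_insert a S).trans hSA)
    have haA : a ∈ A := hSA (Finset.mem_insert_self a S)
    have hqa : dist q (z a) < 2 * r (z a) := by
      linarith [dist_triangle q y (z a), hqy _ (hr0 (z a)) hmax, hyz a haA]
    refine ⟨a :: l, ?_, fun i => by simp [hl], z a, ⟨hz a haA, ?_⟩, fun ρ _ h => ?_⟩
    · rw [Finset.card_insert_of_notMem haS, List.length_cons]
      omega
    · exact hr (z a) _ ⟨l, hlen.trans (Finset.card_le_univ S), rfl⟩ ⟨q, hq, hqa⟩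
    · rw [dist_comm]
      exact (hyz a haA).trans_le (h a (Finset.mem_insert_self a S))

end NestedLimits

section Gaps

variable {X : Type*} [MetricSpace X] {n : ℕ} {I : Fin n → Set (Set ℕ)} {f : ℕ → X} {a : Set ℕ}

/-- A multiple gap on `a` has a nested limit point along some enumeration of its indices. -/
theorem MultiGap.exists_nestedLimits [CompactSpace X] (hIdeal : ∀ i, IsIdeal (I i))
    {A : Set (Fin n)} (hA : MultiGap A fun i => Restrict (I i) a) (f : ℕ → X) :
    ∃ l : List (Fin n), (∀ i, i ∈ l ↔ i ∈ A) ∧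
      (nestedLimits (fun i => limitSet f (I i) a) l).Nonempty := by
  classical
  obtain ⟨r, hr0, hr⟩ := exists_radii_nestedLimits fun i => limitSet f (I i) a
  have hle : ∀ i ∈ A, IdealLe (Restrict (I i) a)
      {m | ∃ z ∈ limitSet f (I i) a, dist (f m) z < r z} := by
    rintro i - x ⟨hx, hxa⟩
    by_contra hinf
    obtain ⟨y, hyx, hy, z, hyz⟩ := exists_convAlong_subset f (Set.Infinite.sdiff hinf hxa)
    have hya : y ⊆ a := fun m hm => by
      by_contra hma
      exact (hyx hm).2 ⟨(hyx hm).1.1, hma⟩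
    have hz : z ∈ limitSet f (I i) a :=
      ⟨y, (hIdeal i).2.2 x hx y fun m hm => (hyx hm).1.1, hy, hya, hyz⟩
    obtain ⟨m, hm, hmz⟩ := (hyz.exists_mem_dist_lt hy (hr0 z)).nonempty
    exact (hyx hm).1.2 ⟨z, hz, hmz⟩
  obtain ⟨m, hm⟩ := (hA.2 _ hle).nonempty
  obtain ⟨l, hl, hne⟩ := hr A.toFinset (f m) fun i hi =>
    Set.mem_iInter₂.1 hm i (Set.mem_toFinset.1 hi)
  exact ⟨l, fun i => by simp [hl], hne⟩

/-- Near a nested limit point along `l` there is a set on which the ideals indexed by `l` form a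
multiple gap and which is orthogonal to all the other ideals. -/
theorem exists_gap_of_mem_nestedLimits (hIdeal : ∀ i, IsIdeal (I i))
    (horth : ∀ i j, i ≠ j → Orth (I i) (I j)) (hdense : DenseFam I)
    (hsep : ∀ i j z, z ∈ limitSet f (I i) Set.univ → z ∈ limitSet f (I j) Set.univ → i = j)
    (l : List (Fin n)) (hl : l ≠ []) (z : X)
    (hz : z ∈ nestedLimits (fun i => limitSet f (I i) a) l) (ε : ℝ) (hε : 0 < ε) :
    ∃ b ⊆ a, (∀ m ∈ b, dist (f m) z < ε) ∧ (∀ j ∉ l, InPerp b (I j)) ∧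
      ∀ c : Fin n → Set ℕ, (∀ i ∈ l, IdealLe (Restrict (I i) b) (c i)) →
        {m ∈ b | ∀ i ∈ l, m ∈ c i}.Infinite := by
  induction l generalizing z ε with
  | nil => exact absurd rfl hl
  | cons j t ih =>
    obtain ⟨hzj, hzt⟩ := hz
    obtain ⟨x, hx, hxinf, hxa, hxz⟩ := hzj
    rcases eq_or_ne t [] with rfl | ht
    · refine ⟨{m ∈ x | dist (f m) z < ε}, fun m hm => hxa hm.1, fun m hm => hm.2, ?_, ?_⟩
      · intro i hi y hy
        refine (horth j i (fun h => hi (by simp [h])) x hx y hy).subset ?_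
        exact Set.inter_subset_inter_left _ fun m hm => hm.1
      · intro c hc
        have hfin := hc j (by simp) {m ∈ x | dist (f m) z < ε}
          ⟨(hIdeal j).2.2 x hx _ fun m hm => hm.1, by simp⟩
        refine ((hxz.exists_mem_dist_lt hxinf hε).sdiff hfin).mono ?_
        rintro m ⟨hm, hn⟩
        refine ⟨hm, fun i hi => ?_⟩
        obtain rfl : i = j := by simpa using hi
        by_contra h
        exact hn ⟨hm, h⟩
    · have hstep : ∀ m : ℕ, ∃ b ⊆ a,
          (∀ p ∈ b, dist (f p) z < 1 / ((m : ℝ) + 1)) ∧ (∀ p ∈ b, dist (f p) z < ε) ∧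
          (∀ j ∉ t, InPerp b (I j)) ∧
          ∀ c : Fin n → Set ℕ, (∀ i ∈ t, IdealLe (Restrict (I i) b) (c i)) →
            {m ∈ b | ∀ i ∈ t, m ∈ c i}.Infinite := by
        intro m
        have hδ : 0 < min ε (1 / ((m : ℝ) + 1)) := lt_min hε (by positivity)
        obtain ⟨w, hw, hzw⟩ := Metric.mem_closure_iff.1 hzt _ (half_pos hδ)
        obtain ⟨b, hba, hbw, hperp, hgap⟩ := ih ht w hw _ (half_pos hδ)
        have hbz : ∀ p ∈ b, dist (f p) z < min ε (1 / ((m : ℝ) + 1)) := fun p hp => by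
          linarith [dist_triangle_right (f p) z w, hbw p hp]
        exact ⟨b, hba, fun p hp => (hbz p hp).trans_le (min_le_right _ _),
          fun p hp => (hbz p hp).trans_le (min_le_left _ _), hperp, hgap⟩
      choose b hba hbz hbε hperp hgap using hstep
      refine ⟨⋃ m, b m, Set.iUnion_subset hba, ?_, ?_, ?_⟩
      · intro p hp
        obtain ⟨m, hm⟩ := Set.mem_iUnion.1 hp
        exact hbε m p hm
      · intro i hi y hy
        rw [List.mem_cons, not_or] at hi
        have hconv := convAlong_iUnion_inter hbz fun m => hperp m i hi.2 y hy
        by_contra hinf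
        exact hi.1 (hsep i j z
          ⟨_, (hIdeal i).2.2 y hy _ Set.inter_subset_right, hinf, Set.subset_univ _, hconv⟩
          ⟨x, hx, hxinf, Set.subset_univ _, hxz⟩)
      · intro c hc
        have hpt : ∀ m : ℕ, ∃ p ∈ b m, (∀ i ∈ t, p ∈ c i) ∧ m < p := by
          intro m
          obtain ⟨p, hp, hmp⟩ := (hgap m c fun i hi y hy =>
            hc i (List.mem_cons_of_mem _ hi) y ⟨hy.1, hy.2.subset
              (Set.sdiff_subset_sdiff_right (Set.subset_iUnion b m))⟩).exists_gt m
          exact ⟨p, hp.1, hp.2, hmp⟩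
        choose p hpb hpc hmp using hpt
        have hinf : (Set.range p).Infinite :=
          Set.infinite_of_not_bddAbove fun ⟨N, hN⟩ =>
            absurd (hN ⟨N, rfl⟩) (not_le.2 (hmp N))
        have hconv : ConvAlong f (Set.range p) z := by
          have := convAlong_iUnion_inter (b := fun m => {p m}) (x := Set.univ) (f := f) (z := z)
            (by rintro m _ rfl; exact hbz m _ (hpb m))
            fun m => (Set.finite_singleton _).subset Set.inter_subset_left
          exact this.mono fun q ⟨m, hm⟩ => ⟨Set.mem_iUnion.2 ⟨m, hm.symm⟩, Set.mem_univ _⟩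
        obtain ⟨i, y, hy, hyp, hyinf⟩ := hdense _ hinf
        obtain rfl : i = j := hsep i j z
          ⟨y, hy, hyinf, Set.subset_univ _, hconv.mono hyp⟩
          ⟨x, hx, hxinf, Set.subset_univ _, hxz⟩
        have hyb : y ⊆ ⋃ m, b m := fun q hq => by
          obtain ⟨m, rfl⟩ := hyp hq
          exact Set.mem_iUnion.2 ⟨m, hpb m⟩
        have hfin := hc i (by simp) y ⟨hy, by simp [Set.sdiff_eq_empty.2 hyb]⟩
        refine (hyinf.sdiff hfin).mono ?_
        rintro q ⟨hq, hn⟩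
        refine ⟨hyb hq, fun k hk => ?_⟩
        rcases List.mem_cons.1 hk with rfl | hk
        · by_contra h
          exact hn ⟨hq, h⟩
        · obtain ⟨m, rfl⟩ := hyp hq
          exact hpc m k hk

/-- A family of ideals whose limit points under a map to a compact metric space are pairwise
distinct is a jigsaw, provided it is dense. -/
theorem isBJigsaw_of_limitSet_disjoint [CompactSpace X] (hIdeal : ∀ i, IsIdeal (I i))
    (horth : ∀ i j, i ≠ j → Orth (I i) (I j)) (hdense : DenseFam I)
    (hsep : ∀ i j z, z ∈ limitSet f (I i) Set.univ → z ∈ limitSet f (I j) Set.univ → i = j)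
    {B : Set (Fin n)} (hB : B.Nonempty) : IsBJigsaw I B := by
  classical
  intro A hBA a hA
  obtain ⟨l, hl, z, hz⟩ := hA.exists_nestedLimits hIdeal f
  obtain ⟨w, hw⟩ := closure_nonempty_iff.1
    ⟨z, nestedLimits_subset_closure_filter _ (fun i => decide (i ∈ B)) l hz⟩
  have hmem : ∀ i, i ∈ l.filter (fun i => decide (i ∈ B)) ↔ i ∈ B := fun i => by
    simpa [hl] using fun h => hBA h
  obtain ⟨k, hk⟩ := hB
  obtain ⟨b, hba, -, hperp, hgap⟩ := exists_gap_of_mem_nestedLimits hIdeal horth hdense hsep _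
    (List.ne_nil_of_mem ((hmem k).2 hk)) w hw 1 one_pos
  refine ⟨b, hba, ⟨fun i _ j _ hij x hx y hy => horth i j hij x hx.1 y hy.1, fun c hc => ?_⟩,
    fun i hi => hperp i fun h => hi.2 ((hmem i).1 h)⟩
  refine (hgap c fun i hi => hc i ((hmem i).1 hi)).mono fun m hm => ?_
  exact Set.mem_iInter₂.2 fun i hi => hm.2 i ((hmem i).2 hi)

end Gaps

open Classical in
/-- The map recording membership in countably many sets `c i k` that strongly separate the ideals
gives distinct ideals distinct limit points. -/
theorem eq_of_mem_limitSet_of_separation {n : ℕ} {I : Fin n → Set (Set ℕ)}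
    [MetricSpace (Fin n × ℕ → Bool)]
    (htop : ∀ (e : Fin n × ℕ) (z : Fin n × ℕ → Bool),
      ∃ ε > 0, ∀ w : Fin n × ℕ → Bool, dist w z < ε → w e = z e)
    (hIdeal : ∀ i, IsIdeal (I i)) {c : Fin n → ℕ → Set ℕ}
    (hdisj : ∀ k, ∀ i j : Fin n, i ≠ j → (c i k ∩ c j k).Finite)
    (hsep : ∀ x : Fin n → Set ℕ, (∀ i, x i ∈ I i) → ∃ k, ∀ i, (x i \ c i k).Finite)
    (i j : Fin n) (z : Fin n × ℕ → Bool)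
    (hi : z ∈ limitSet (fun m e => decide (m ∈ c e.1 e.2)) (I i) Set.univ)
    (hj : z ∈ limitSet (fun m e => decide (m ∈ c e.1 e.2)) (I j) Set.univ) : i = j := by
  classical
  by_contra hij
  obtain ⟨x, hx, hxinf, -, hxz⟩ := hi
  obtain ⟨y, hy, hyinf, -, hyz⟩ := hj
  obtain ⟨k, hk⟩ := hsep (fun l => if l = i then x else if l = j then y else ∅) fun l => by
    split_ifs with h₁ h₂
    · exact h₁ ▸ hx
    · exact h₂ ▸ hy
    · exact (hIdeal l).1 ∅ Set.finite_empty
  have hxk : (x \ c i k).Finite := by simpa using hk i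
  have hyk : (y \ c j k).Finite := by simpa [Ne.symm hij] using hk j
  obtain ⟨ε, hε, h⟩ := htop (j, k) z
  obtain ⟨p, ⟨⟨hpy, hpz⟩, hpn⟩⟩ := ((hyz.exists_mem_dist_lt hyinf hε).sdiff hyk).nonempty
  have hzj : z (j, k) = true := (h _ hpz).symm.trans (decide_eq_true (by
    by_contra hp
    exact hpn ⟨hpy, hp⟩))
  obtain ⟨q, ⟨⟨⟨hqx, hqz⟩, hqn⟩, hqd⟩⟩ :=
    (((hxz.exists_mem_dist_lt hxinf hε).sdiff hxk).sdiff (hdisj k i j hij)).nonempty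
  have hqi : q ∈ c i k := by
    by_contra hq
    exact hqn ⟨hqx, hq⟩
  exact hqd ⟨hqi, of_decide_eq_true ((h _ hqz).trans hzj)⟩

/-- Every strongly countably separated dense `n`-gap on `ω` is a jigsaw. -/
theorem stronglyCS_dense_gap_is_jigsaw
    (n : ℕ) (I : Fin n → Set (Set ℕ))
    (hIdeal : ∀ i, IsIdeal (I i))
    (hgap : IsGap I)
    (hscs : StronglyCS I)
    (hdense : DenseFam I) :
    ∀ B : Set (Fin n), B.Nonempty → B ≠ Set.univ → IsBJigsaw I B := by
  classical
  intro B hB _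
  obtain ⟨c, hdisj, hsep⟩ := hscs
  have hopen : ∀ (e : Fin n × ℕ) (z : Fin n × ℕ → Bool), IsOpen {w : Fin n × ℕ → Bool | w e = z e} :=
    fun e z => (isOpen_discrete ({z e} : Set Bool)).preimage
      (continuous_apply (A := fun _ => Bool) e)
  let : MetricSpace (Fin n × ℕ → Bool) := TopologicalSpace.metrizableSpaceMetric _
  exact isBJigsaw_of_limitSet_disjoint hIdeal
    (fun i j hij => hgap.1 i (Set.mem_univ i) j (Set.mem_univ j) hij) hdense
    (eq_of_mem_limitSet_of_separation (fun e z => Metric.isOpen_iff.1 (hopen e z) z rfl)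
      hIdeal hdisj hsep) hB
end

section
/- Let n ∈ ω, let 𝔛 be an upwards-closed family of subsets of n (A ∈ 𝔛 and A ⊆ B ⊆ n imply B ∈ 𝔛), and let {I_i : i < n} be countably generated ideals on ω such that for every A ∈ 𝔛 and every choice x_i ∈ I_i (i ∈ A), the set ⋂_{i∈A} x_i is finite. Then there exist sets c_i ⊆ ω (i < n) such that I_i ≤ c_i for every i < n and ⋂_{i∈A} c_i is finite for every A ∈ 𝔛. -/
/-- An ideal is countably generated: some countable subfamily is cofinal mod finite. -/
def CountablyGenerated' {E : Type*} (I : Set (Set E)) : Prop :=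
  ∃ g : ℕ → Set E, (∀ k, g k ∈ I) ∧
    ∀ x ∈ I, ∃ F : Finset ℕ, (x \ ⋃ k ∈ F, g k).Finite

/-- The partial unions of a sequence of members of an ideal belong to the ideal. -/
theorem IsIdeal.partialSups_mem {E : Type*} {I : Set (Set E)} (hI : IsIdeal I)
    {g : ℕ → Set E} (hg : ∀ k, g k ∈ I) (k : ℕ) : partialSups g k ∈ I := by
  induction k with
  | zero => simpa using hg 0
  | succ k ih =>
    rw [partialSups_add_one]
    exact hI.2.1 _ ih _ (hg _)

/-- A bound for all members of a cofinal subfamily bounds the whole family. -/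
theorem idealLe_of_cofinal {E : Type*} {I : Set (Set E)} {g : ℕ → Set E} {c : Set E}
    (hg : ∀ x ∈ I, ∃ F : Finset ℕ, (x \ ⋃ k ∈ F, g k).Finite)
    (hc : ∀ k, (g k \ c).Finite) : IdealLe I c := by
  intro x hx
  obtain ⟨F, hF⟩ := hg x hx
  refine (hF.union (F.finite_toSet.biUnion fun k _ => hc k)).subset ?_
  intro m ⟨hm, hmc⟩
  by_cases h : m ∈ ⋃ k ∈ F, g k
  · simp only [Set.mem_iUnion] at h
    obtain ⟨k, hk, hmk⟩ := h
    exact Or.inr (Set.mem_biUnion hk ⟨hmk, hmc⟩)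
  · exact Or.inl ⟨hm, h⟩

/-- Separation of countably generated ideals along an upwards closed family `𝔛`:
if all `𝔛`-intersections of members are finite, then there are bounds `c_i ≥ I_i`
whose `𝔛`-intersections are finite. (ZFC instance, `θ = ℵ₀`, `k = 1`.) -/
theorem countably_generated_separation
    (n : ℕ) (𝔛 : Set (Set (Fin n)))
    (hup : ∀ A ∈ 𝔛, ∀ B : Set (Fin n), A ⊆ B → B ∈ 𝔛)
    (I : Fin n → Set (Set ℕ))
    (hIdeal : ∀ i, IsIdeal (I i))
    (hcg : ∀ i, CountablyGenerated' (I i))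
    (horth : ∀ A ∈ 𝔛, ∀ x : Fin n → Set ℕ,
      (∀ i ∈ A, x i ∈ I i) → (⋂ i ∈ A, x i).Finite) :
    ∃ c : Fin n → Set ℕ,
      (∀ i, IdealLe (I i) (c i)) ∧
      ∀ A ∈ 𝔛, (⋂ i ∈ A, c i).Finite := by
  choose g hgI hg using hcg
  have hbdd : ∀ k, ∃ N, ∀ A ∈ 𝔛, ∀ m ∈ ⋂ i ∈ A, partialSups (g i) k, m < N := by
    intro k
    have hfin : (⋃ A ∈ 𝔛, ⋂ i ∈ A, partialSups (g i) k).Finite :=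
      𝔛.toFinite.biUnion fun A hA =>
        horth A hA _ fun i _ => (hIdeal i).partialSups_mem (hgI i) k
    obtain ⟨N, hN⟩ := hfin.bddAbove
    exact ⟨N + 1, fun A hA m hm => Nat.lt_succ_of_le (hN (Set.mem_biUnion hA hm))⟩
  choose f hf using hbdd
  refine ⟨fun i => {m | ∃ k, m ∈ partialSups (g i) k ∧ f k ≤ m}, fun i => ?_, fun A hA => ?_⟩
  · refine idealLe_of_cofinal (hg i) fun k => (Set.finite_Iio (f k)).subset ?_
    intro m ⟨hm, hmc⟩
    by_contra h
    exact hmc ⟨k, le_partialSups (g i) k hm, not_lt.mp h⟩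
  · rcases A.eq_empty_or_nonempty with rfl | hne
    · exact absurd (horth ∅ hA (fun _ => ∅) (by simp)) (by simpa using Set.infinite_univ)
    · refine Set.finite_empty.subset fun m hm => ?_
      simp only [Set.mem_iInter, Set.mem_ofPred_eq] at hm
      choose! κ hκ hfκ using hm
      obtain ⟨j, hjA, hj⟩ := A.toFinite.exists_maximalFor κ A hne
      have hmem : m ∈ ⋂ i ∈ A, partialSups (g i) (κ j) :=
        Set.mem_iInter₂.mpr fun i hi =>
          (partialSups (g i)).monotone ((le_total (κ i) (κ j)).elim id (hj hi)) (hκ i hi)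
      exact absurd (hf _ A hA m hmem) (not_lt.mpr (hfκ j hjA))
end
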